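/- arXiv:0806.4820 — 2 statements merged into one kernel-verified Lean document; each statement's English description precedes it below -/
import Mathlib

section
/- Let G = ⊕_{n≥0} G_n be a positively graded Noetherian ring with (G_0, 𝔫) local, G = G_0[G_1], and G_0/𝔫 infinite, let L be a finitely generated graded G-module, and let d be a positive integer with dim_G L ≤ d. Then j_d(G, L) ≠ 0 if and only if ℓ(G, L) = d. -/
open Filter

noncomputable section

/-- The length of a module, as the height of `⊤` in the submodule lattice. -/
def mLength (R M : Type*) [CommRing R] [AddCommGroup M] [Module R M] : ℕ∞ :=
  Order.height (⊤ : Submodule R M)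

/-- The Krull dimension of a module, via the annihilator. -/
def mDim (R M : Type*) [CommRing R] [AddCommGroup M] [Module R M] : WithBot ℕ∞ :=
  ringKrullDim (R ⧸ Module.annihilator R M)

/-- `H⁰_I(N)`: elements killed by a power of `I` (0-th local cohomology). -/
def H0 {R : Type*} [CommRing R] (I : Ideal R) (N : Type*) [AddCommGroup N] [Module R N] :
    Submodule R N :=
  ⨆ n : ℕ, Submodule.torsionBySet R N ((I ^ n : Ideal R) : Set R)

/-- The irrelevant ideal `G₊` of a positively graded ring: the ideal generated by the
homogeneous elements of positive degree. -/
def gPlus {R G : Type*} [CommRing R] [CommRing G] [Algebra R G]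
    (𝒜 : ℕ → Submodule R G) : Ideal G :=
  Ideal.span {x : G | ∃ n : ℕ, 0 < n ∧ x ∈ 𝒜 n}

/-- `f` is `G₊`-filter regular for a `G`-module `L`: `f ∉ P` for every associated prime
`P` of `L` with `G₊ ⊄ P`. -/
def FilterRegular {R G : Type*} [CommRing R] [CommRing G] [Algebra R G]
    (𝒜 : ℕ → Submodule R G) (f : G) (L : Type*) [AddCommGroup L] [Module G L] : Prop :=
  ∀ P ∈ associatedPrimes G L, ¬ gPlus 𝒜 ≤ P → f ∉ P

/-- The `j`-multiplicity `j_d(G, L)` of a graded module `L` with components `comp` over a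
graded ring `G` with `𝔫G = nG`: the limit of `(d−1)!/n^(d−1) · length_{G₀} Wₙ`, where
`W = H⁰_{𝔫G}(L)` and `Wₙ` is its `n`-th graded component. -/
def jMultGr (R : Type*) {G : Type*} [CommRing R] [CommRing G] [Algebra R G] (nG : Ideal G)
    (L : Type*) [AddCommGroup L] [Module R L] [Module G L] [IsScalarTower R G L]
    (comp : ℕ → Submodule R L) (d : ℕ) : ℝ :=
  limUnder atTop fun n : ℕ =>
    ((d - 1).factorial : ℝ) / (n : ℝ) ^ (d - 1) *
      ((mLength R (Submodule.restrictScalars R (H0 nG L) ⊓ comp n : Submodule R L)).toNat : ℝ)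

section Graded

variable {R G : Type*} [CommRing R] [CommRing G] [Algebra R G] (𝒜 : ℕ → Submodule R G)
  {L : Type*} [AddCommGroup L] [Module R L] [Module G L] [IsScalarTower R G L]
  (ℳ : ℕ → Submodule R L) [DirectSum.Decomposition ℳ]

/-- The projection onto the `n`-th component of a graded module, as an endomorphism. -/
def gproj (n : ℕ) : L →ₗ[R] L :=
  (ℳ n).subtype ∘ₗ DirectSum.component R ℕ (fun i => ℳ i) n ∘ₗ
    (DirectSum.decomposeLinearEquiv ℳ).toLinearMap

lemma gproj_mem (n : ℕ) (x : L) : gproj ℳ n x ∈ ℳ n :=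
  (DirectSum.decompose ℳ x n).2

lemma gproj_of_mem {n : ℕ} {x : L} (hx : x ∈ ℳ n) : gproj ℳ n x = x :=
  DirectSum.decompose_of_mem_same ℳ hx

lemma gproj_of_mem_ne {m n : ℕ} {x : L} (hx : x ∈ ℳ m) (h : m ≠ n) : gproj ℳ n x = 0 :=
  DirectSum.decompose_of_mem_ne ℳ hx h

lemma exists_sum_gproj (x : L) : ∃ s : Finset ℕ, x = ∑ i ∈ s, gproj ℳ i x := by
  classical
  exact ⟨_, (DirectSum.sum_support_decompose ℳ x).symm⟩

lemma graded_induction {p : L → Prop} (x : L) (h0 : p 0) (hadd : ∀ a b, p a → p b → p (a + b))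
    (h : ∀ n, ∀ a ∈ ℳ n, p a) : p x := by
  obtain ⟨s, hs⟩ := exists_sum_gproj ℳ x
  rw [hs]
  exact Finset.sum_induction _ p hadd h0 fun i _ => h i _ (gproj_mem ℳ i x)

variable [SetLike.GradedSMul 𝒜 ℳ]

lemma smul_mem_add {i j : ℕ} {a : G} {m : L} (ha : a ∈ 𝒜 i) (hm : m ∈ ℳ j) :
    a • m ∈ ℳ (i + j) :=
  SetLike.GradedSMul.smul_mem ha hm

lemma gproj_smul_add {i : ℕ} {a : G} (ha : a ∈ 𝒜 i) (j : ℕ) (x : L) :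
    gproj ℳ (i + j) (a • x) = a • gproj ℳ j x := by
  induction x using graded_induction ℳ with
  | h0 => simp
  | hadd u v hu hv => simp [smul_add, hu, hv]
  | h n u hu =>
    by_cases h : n = j
    · subst h
      rw [gproj_of_mem ℳ hu, gproj_of_mem ℳ (smul_mem_add 𝒜 ℳ ha hu)]
    · rw [gproj_of_mem_ne ℳ hu h, gproj_of_mem_ne ℳ (smul_mem_add 𝒜 ℳ ha hu) (by omega), smul_zero]

lemma gproj_smul_lt {i : ℕ} {a : G} (ha : a ∈ 𝒜 i) {n : ℕ} (hn : n < i) (x : L) :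
    gproj ℳ n (a • x) = 0 := by
  induction x using graded_induction ℳ with
  | h0 => simp
  | hadd u v hu hv => simp [smul_add, hu, hv]
  | h m u hu => rw [gproj_of_mem_ne ℳ (smul_mem_add 𝒜 ℳ ha hu) (by omega)]

lemma gproj_smul_of_mem [GradedAlgebra 𝒜] {j : ℕ} {x : L} (hx : x ∈ ℳ j) (i : ℕ) (g : G) :
    gproj ℳ (i + j) (g • x) = gproj 𝒜 i g • x := by
  induction g using graded_induction 𝒜 with
  | h0 => simp
  | hadd u v hu hv => simp [add_smul, hu, hv]
  | h n u hu =>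
    by_cases h : n = i
    · subst h
      rw [gproj_of_mem 𝒜 hu, gproj_of_mem ℳ (smul_mem_add 𝒜 ℳ hu hx)]
    · rw [gproj_of_mem_ne 𝒜 hu h, gproj_of_mem_ne ℳ (smul_mem_add 𝒜 ℳ hu hx) (by omega), zero_smul]

lemma smul_mem_of_degree_zero [GradedAlgebra 𝒜] (h0 : 𝒜 0 = 1) (V : Submodule R L) {a : G}
    (ha : a ∈ 𝒜 0) {x : L} (hx : x ∈ V) : a • x ∈ V := by
  rw [h0, Submodule.mem_one] at ha
  obtain ⟨r, rfl⟩ := ha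
  rw [algebraMap_smul]
  exact V.smul_mem r hx

lemma gproj_mem_of_mem_span [GradedAlgebra 𝒜] (h0 : 𝒜 0 = 1) {n : ℕ} (V : Submodule R L)
    (hV : V ≤ ℳ n) {y : L} (hy : y ∈ Submodule.span G (V : Set L)) : gproj ℳ n y ∈ V := by
  induction hy using Submodule.span_induction with
  | mem x h => rwa [gproj_of_mem ℳ (hV h)]
  | zero => simp
  | add x y _ _ hx hy => rw [map_add]; exact add_mem hx hy
  | smul a x hx' hx =>
    clear hx
    induction hx' using Submodule.span_induction generalizing a with
    | mem x h =>
      have := gproj_smul_of_mem 𝒜 ℳ (hV h) 0 a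
      rw [zero_add] at this
      rw [this]
      exact smul_mem_of_degree_zero 𝒜 h0 V (gproj_mem 𝒜 0 a) h
    | zero => simp
    | add x y _ _ hx hy => rw [smul_add, map_add]; exact add_mem (hx a) (hy a)
    | smul b x _ hx => rw [smul_smul]; exact hx _

/-- The components of a Noetherian graded module are Noetherian over the base. -/
lemma isNoetherian_component [GradedAlgebra 𝒜] (h0 : 𝒜 0 = 1) [IsNoetherian G L] (n : ℕ) :
    IsNoetherian R (ℳ n) := by
  rw [isNoetherian_iff']
  let f : Submodule R (ℳ n) → Submodule G L := fun V =>
    Submodule.span G (V.map (ℳ n).subtype : Set L)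
  have hf : Monotone f := fun V V' h => Submodule.span_mono (Submodule.map_mono h)
  have hle : ∀ V V', f V ≤ f V' → V ≤ V' := by
    intro V V' h v hv
    have h1 : (v : L) ∈ f V' := h (Submodule.subset_span ⟨v, hv, rfl⟩)
    have h2 := gproj_mem_of_mem_span 𝒜 ℳ h0 (n := n) (V'.map (ℳ n).subtype)
      (Submodule.map_subtype_le _ _) h1
    rw [gproj_of_mem ℳ v.2] at h2
    obtain ⟨w, hw, hwv⟩ := h2
    rwa [← Subtype.ext hwv]
  exact (show StrictMono f from fun V V' h =>
    lt_of_le_not_ge (hf h.le) fun h' => h.not_ge (hle _ _ h')).wellFoundedGT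

/-- A submodule of a graded module is homogeneous if it contains the components of its elements. -/
def IsHomog (N : Submodule G L) : Prop := ∀ n, ∀ x ∈ N, gproj ℳ n x ∈ N

/-- The degree `n` component of a submodule, as a module over the base. -/
abbrev gcomp (N : Submodule G L) (n : ℕ) : Submodule R L := N.restrictScalars R ⊓ ℳ n

/-- A homogeneous submodule of a Noetherian module over a standard graded algebra is eventually
generated by the preceding component. -/
lemma exists_forall_gcomp_succ_le [GradedAlgebra 𝒜] (hstd : ∀ n, 𝒜 n = 𝒜 1 ^ n)
    [IsNoetherian G L] (N : Submodule G L) :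
    ∃ c, ∀ n ≥ c, ∀ U : Submodule R L, (∀ a ∈ 𝒜 1, ∀ v ∈ gcomp ℳ N n, a • v ∈ U) →
      gcomp ℳ N (n + 1) ≤ U := by
  let F : ℕ →o Submodule G L :=
    ⟨fun n => Submodule.span G {x | ∃ i ≤ n, x ∈ gcomp ℳ N i}, fun m n h =>
      Submodule.span_mono fun x ⟨i, hi, hx⟩ => ⟨i, hi.trans h, hx⟩⟩
  obtain ⟨c, hc⟩ := monotone_stabilizes_iff_noetherian.mpr ‹IsNoetherian G L› F
  refine ⟨c, fun n hn U hU x hx => ?_⟩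
  have hx1 : x ∈ F n := by
    rw [← hc n hn, hc (n + 1) (by omega)]
    exact Submodule.subset_span ⟨n + 1, le_rfl, hx⟩
  have key : ∀ y ∈ F n, ∀ a : G, gproj ℳ (n + 1) (a • y) ∈ U := by
    intro y hy
    induction hy using Submodule.span_induction with
    | zero => simp
    | add x y _ _ hx hy =>
      intro a
      rw [smul_add, map_add]
      exact add_mem (hx a) (hy a)
    | smul b x _ hx => intro a; rw [smul_smul]; exact hx _
    | mem v hv =>
      obtain ⟨i, hi, hvN, hvi⟩ := hv
      intro a
      obtain ⟨k, rfl⟩ := Nat.exists_eq_add_of_le' hi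
      have h1 := gproj_smul_of_mem 𝒜 ℳ hvi (1 + k) a
      rw [show k + i + 1 = 1 + k + i by omega, h1]
      have h2 : gproj 𝒜 (1 + k) a ∈ 𝒜 1 * 𝒜 k := by
        have := gproj_mem 𝒜 (1 + k) a
        rwa [hstd, pow_add, pow_one, ← hstd k] at this
      generalize gproj 𝒜 (1 + k) a = b at h2
      induction h2 using Submodule.mul_induction_on' with
      | mem_mul_mem p hp q hq =>
        rw [mul_smul]
        exact hU p hp _ ⟨N.smul_mem q hvN, smul_mem_add 𝒜 ℳ hq hvi⟩
      | add p _ q _ hp hq => rw [add_smul]; exact add_mem hp hq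
  have := key x hx1 1
  rwa [one_smul, gproj_of_mem ℳ hx.2] at this

end Graded

section EventuallyPolynomial

open Polynomial

/-- A function on `ℕ` that agrees with a polynomial for large arguments. -/
def EventuallyPoly (f : ℕ → ℚ) : Prop := ∃ P : ℚ[X], ∀ᶠ n in atTop, f n = P.eval (n : ℚ)

lemma EventuallyPoly.sub {f g : ℕ → ℚ} (hf : EventuallyPoly f) (hg : EventuallyPoly g) :
    EventuallyPoly (fun n => f n - g n) := by
  obtain ⟨P, hP⟩ := hf
  obtain ⟨Q, hQ⟩ := hg
  refine ⟨P - Q, ?_⟩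
  filter_upwards [hP, hQ] with n h1 h2
  rw [h1, h2, eval_sub]

lemma EventuallyPoly.comp_succ {f : ℕ → ℚ} (hf : EventuallyPoly f) :
    EventuallyPoly (fun n => f (n + 1)) := by
  obtain ⟨P, hP⟩ := hf
  refine ⟨P.comp (X + 1), ?_⟩
  filter_upwards [(tendsto_add_atTop_nat 1).eventually hP] with n h
  simp [h]

lemma exists_polynomial_eval_add_one_sub (q : ℚ[X]) :
    ∃ P : ℚ[X], ∀ x : ℚ, P.eval (x + 1) - P.eval x = q.eval x := by
  induction q using Polynomial.induction_on' with
  | add p q hp hq =>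
    obtain ⟨P, hP⟩ := hp
    obtain ⟨Q, hQ⟩ := hq
    exact ⟨P + Q, fun x => by rw [eval_add, eval_add, eval_add, ← hP, ← hQ]; ring⟩
  | monomial n a =>
    refine ⟨C (a / (n + 1)) * Polynomial.bernoulli (n + 1), fun x => ?_⟩
    have := Polynomial.bernoulli_eval_one_add (n + 1) x
    rw [add_comm 1 x] at this
    have h : ((n : ℚ) + 1) ≠ 0 := by positivity
    rw [eval_mul, eval_mul, this, eval_C, eval_C, eval_monomial, ← mul_sub, add_sub_cancel_left,
      Nat.add_sub_cancel]
    push_cast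
    field_simp

lemma EventuallyPoly.of_succ_sub {f : ℕ → ℚ} (hf : EventuallyPoly (fun n => f (n + 1) - f n)) :
    EventuallyPoly f := by
  obtain ⟨q, hq⟩ := hf
  obtain ⟨P, hP⟩ := exists_polynomial_eval_add_one_sub q
  obtain ⟨N, hN⟩ := eventually_atTop.mp hq
  refine ⟨P + C (f N - P.eval (N : ℚ)), eventually_atTop.mpr ⟨N, fun n hn => ?_⟩⟩
  induction n, hn using Nat.le_induction with
  | base => simp
  | succ n hn ih =>
    have h1 := hN n hn
    have h2 := hP n
    simp only [eval_add, eval_C] at ih ⊢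
    push_cast
    linarith

end EventuallyPolynomial

section Length

variable {R : Type*} [CommRing R] {M P : Type*} [AddCommGroup M] [Module R M]
  [AddCommGroup P] [Module R P]

lemma length_eq_inf_ker_add_map (A : Submodule R M) (g : M →ₗ[R] P) :
    Module.length R A = Module.length R (A ⊓ LinearMap.ker g : Submodule R M) +
      Module.length R (A.map g) := by
  refine Module.length_eq_add_of_exact (Submodule.inclusion inf_le_left)
    ((g.domRestrict A).codRestrict (A.map g) fun x => ⟨x, x.2, rfl⟩)
    (Submodule.inclusion_injective _) ?_ ?_
  · rintro ⟨_, x, hx, rfl⟩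
    exact ⟨⟨x, hx⟩, rfl⟩
  · rintro ⟨x, hx⟩
    constructor
    · intro h
      exact ⟨⟨x, hx, congrArg Subtype.val h⟩, rfl⟩
    · rintro ⟨⟨y, hy⟩, h⟩
      have : y = x := congrArg Subtype.val h
      subst this
      exact Subtype.ext hy.2

lemma length_submodule_mono {A B : Submodule R M} (h : A ≤ B) :
    Module.length R A ≤ Module.length R B :=
  Module.length_le_of_injective (Submodule.inclusion h) (Submodule.inclusion_injective h)

lemma length_add_length_eq_of_linearMap (f : M →ₗ[R] M) (A B : Submodule R M) :
    Module.length R A + Module.length R B =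
      Module.length R (A ⊓ B.comap f : Submodule R M) +
        Module.length R (B ⊔ A.map f : Submodule R M) := by
  have h1 := length_eq_inf_ker_add_map A (B.mkQ ∘ₗ f)
  have h2 := length_eq_inf_ker_add_map (B ⊔ A.map f) B.mkQ
  rw [Submodule.ker_mkQ, inf_eq_right.mpr le_sup_left, Submodule.map_sup, Submodule.mkQ_map_self,
    bot_sup_eq, ← Submodule.map_comp] at h2
  rw [LinearMap.ker_comp, Submodule.ker_mkQ] at h1
  rw [h1, h2]
  ring

end Length

section HilbertSerre

variable {R G : Type*} [CommRing R] [CommRing G] [Algebra R G] (𝒜 : ℕ → Submodule R G)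
  {L : Type*} [AddCommGroup L] [Module R L] [Module G L] [IsScalarTower R G L]
  (ℳ : ℕ → Submodule R L) [DirectSum.Decomposition ℳ]

/-- The Hilbert function of a submodule of a graded module. -/
def hilb (N : Submodule G L) (n : ℕ) : ℕ := (Module.length R (gcomp ℳ N n)).toNat

lemma IsHomog.inf {N N' : Submodule G L} (h : IsHomog ℳ N) (h' : IsHomog ℳ N') :
    IsHomog ℳ (N ⊓ N') := fun n x hx => ⟨h n x hx.1, h' n x hx.2⟩

lemma IsHomog.sup {N N' : Submodule G L} (h : IsHomog ℳ N) (h' : IsHomog ℳ N') :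
    IsHomog ℳ (N ⊔ N') := by
  intro n x hx
  obtain ⟨y, hy, z, hz, rfl⟩ := Submodule.mem_sup.mp hx
  rw [map_add]
  exact Submodule.add_mem_sup (h n y hy) (h' n z hz)

variable [SetLike.GradedSMul 𝒜 ℳ]

lemma IsHomog.comap_lsmul {N : Submodule G L} (h : IsHomog ℳ N) {i : ℕ} {a : G} (ha : a ∈ 𝒜 i) :
    IsHomog ℳ (N.comap (Algebra.lsmul G G L a)) := by
  intro n x hx
  change a • gproj ℳ n x ∈ N
  rw [← gproj_smul_add 𝒜 ℳ ha]
  exact h _ _ hx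

lemma IsHomog.map_lsmul {N : Submodule G L} (h : IsHomog ℳ N) {i : ℕ} {a : G} (ha : a ∈ 𝒜 i) :
    IsHomog ℳ (N.map (Algebra.lsmul G G L a)) := by
  rintro n _ ⟨x, hx, rfl⟩
  change gproj ℳ n (a • x) ∈ _
  rcases lt_or_ge n i with hn | hn
  · rw [gproj_smul_lt 𝒜 ℳ ha hn]
    exact zero_mem _
  · obtain ⟨k, rfl⟩ := Nat.exists_eq_add_of_le hn
    rw [gproj_smul_add 𝒜 ℳ ha]
    exact ⟨_, h k x hx, rfl⟩

lemma length_gcomp_add_length_gcomp {N N' : Submodule G L} (hN : IsHomog ℳ N)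
    (hN' : IsHomog ℳ N') {a : G} (ha : a ∈ 𝒜 1) (n : ℕ) :
    Module.length R (gcomp ℳ N n) + Module.length R (gcomp ℳ N' (n + 1)) =
      Module.length R (gcomp ℳ (N ⊓ N'.comap (Algebra.lsmul G G L a)) n) +
        Module.length R (gcomp ℳ (N' ⊔ N.map (Algebra.lsmul G G L a)) (n + 1)) := by
  have h1 : gcomp ℳ N n ⊓ (gcomp ℳ N' (n + 1)).comap (Algebra.lsmul R R L a) =
      gcomp ℳ (N ⊓ N'.comap (Algebra.lsmul G G L a)) n := by
    ext x
    constructor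
    · rintro ⟨⟨h1, h2⟩, h3, h4⟩
      exact ⟨⟨h1, h3⟩, h2⟩
    · rintro ⟨⟨h1, h3⟩, h2⟩
      refine ⟨⟨h1, h2⟩, h3, ?_⟩
      rw [add_comm n 1]
      exact smul_mem_add 𝒜 ℳ ha h2
  have h2 : gcomp ℳ N' (n + 1) ⊔ (gcomp ℳ N n).map (Algebra.lsmul R R L a) =
      gcomp ℳ (N' ⊔ N.map (Algebra.lsmul G G L a)) (n + 1) := by
    apply le_antisymm
    · refine sup_le ?_ ?_
      · exact inf_le_inf_right _ (fun x hx => Submodule.mem_sup_left (S := N') hx)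
      · rintro _ ⟨x, ⟨h1, h2⟩, rfl⟩
        refine ⟨Submodule.mem_sup_right (S := N') ⟨x, h1, rfl⟩, ?_⟩
        rw [add_comm n 1]
        exact smul_mem_add 𝒜 ℳ ha h2
    · rintro x ⟨h1, h2⟩
      obtain ⟨y, hy, _, ⟨z, hz, rfl⟩, rfl⟩ := (Submodule.mem_sup (p := N')).mp h1
      rw [← gproj_of_mem ℳ h2, map_add]
      refine Submodule.add_mem_sup ⟨hN' _ _ hy, gproj_mem _ _ _⟩ ⟨gproj ℳ n z, ⟨hN _ _ hz,
        gproj_mem _ _ _⟩, ?_⟩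
      rw [add_comm n 1]
      exact (gproj_smul_add 𝒜 ℳ ha n z).symm
  rw [length_add_length_eq_of_linearMap (Algebra.lsmul R R L a) (gcomp ℳ N n)
    (gcomp ℳ N' (n + 1)), h1, h2]

lemma eventuallyPoly_hilb_sub [GradedAlgebra 𝒜] (hstd : ∀ n, 𝒜 n = 𝒜 1 ^ n)
    [IsNoetherian G L] {W : Submodule G L} (hfin : ∀ n, Module.length R (gcomp ℳ W n) ≠ ⊤)
    (T : Finset G) (hT : ∀ a ∈ T, a ∈ 𝒜 1) :
    ∀ (V : Submodule R G) (N N' : Submodule G L), 𝒜 1 ≤ V ⊔ Submodule.span R T →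
      (∀ v ∈ V, ∀ y ∈ N, v • y ∈ N') → IsHomog ℳ N → IsHomog ℳ N' → N' ≤ N → N ≤ W →
      EventuallyPoly (fun n => (hilb ℳ N n : ℚ) - hilb ℳ N' n) := by
  classical
  induction T using Finset.induction_on with
  | empty =>
    intro V N N' hV hVN hN hN' hle hW
    obtain ⟨c, hc⟩ := exists_forall_gcomp_succ_le 𝒜 ℳ hstd N
    rw [Finset.coe_empty, Submodule.span_empty, sup_bot_eq] at hV
    refine ⟨0, eventually_atTop.mpr ⟨c + 1, fun n hn => ?_⟩⟩
    obtain ⟨k, rfl⟩ := Nat.exists_eq_add_of_le' hn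
    have : gcomp ℳ N (k + (c + 1)) = gcomp ℳ N' (k + (c + 1)) := by
      refine le_antisymm ?_ (inf_le_inf_right _ hle)
      refine hc (k + c) (by omega) _ fun a ha v hv => ⟨hVN a (hV ha) v hv.1, ?_⟩
      rw [show k + (c + 1) = 1 + (k + c) by omega]
      exact smul_mem_add 𝒜 ℳ ha hv.2
    simp only [hilb]
    rw [this, sub_self, Polynomial.eval_zero]
  | insert x T _ ih =>
    intro V N N' hV hVN hN hN' hle hW
    have hx : x ∈ 𝒜 1 := hT x (Finset.mem_insert_self x T)
    have ih' := ih fun a ha => hT a (Finset.mem_insert_of_mem ha)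
    set C := N' ⊔ N.map (Algebra.lsmul G G L x) with hC
    set K := N ⊓ N'.comap (Algebra.lsmul G G L x) with hK
    have hV' : 𝒜 1 ≤ (V ⊔ Submodule.span R {x}) ⊔ Submodule.span R (T : Set G) := by
      rwa [Finset.coe_insert, Submodule.span_insert, ← sup_assoc] at hV
    have hCN : C ≤ N := sup_le hle (by rintro _ ⟨z, hz, rfl⟩; exact N.smul_mem x hz)
    have hEP1 := ih' (V ⊔ Submodule.span R {x}) N C hV' (by
      intro v hv y hy
      obtain ⟨u, hu, w, hw, rfl⟩ := Submodule.mem_sup.mp hv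
      obtain ⟨r, rfl⟩ := Submodule.mem_span_singleton.mp hw
      rw [add_smul, smul_assoc, ← algebraMap_smul G r (x • y)]
      exact add_mem (Submodule.mem_sup_left (hVN u hu y hy))
        (C.smul_mem _ (Submodule.mem_sup_right ⟨y, hy, rfl⟩)))
      hN (hN'.sup ℳ (hN.map_lsmul 𝒜 ℳ hx)) hCN hW
    have hEP2 := ih' (V ⊔ Submodule.span R {x}) K N' hV' (by
      intro v hv y hy
      obtain ⟨u, hu, w, hw, rfl⟩ := Submodule.mem_sup.mp hv
      obtain ⟨r, rfl⟩ := Submodule.mem_span_singleton.mp hw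
      rw [add_smul, smul_assoc, ← algebraMap_smul G r (x • y)]
      exact add_mem (hVN u hu y hy.1) (N'.smul_mem _ hy.2))
      (hN.inf ℳ (hN'.comap_lsmul 𝒜 ℳ hx)) hN'
      (le_inf hle fun z hz => N'.smul_mem x hz) (inf_le_left.trans hW)
    refine EventuallyPoly.of_succ_sub ?_
    have := hEP1.comp_succ.sub hEP2
    convert this using 2 with n
    have hfin' : ∀ N₁ ≤ W, ∀ n, Module.length R (gcomp ℳ N₁ n) = (hilb ℳ N₁ n : ℕ∞) :=
      fun N₁ h n => (ENat.natCast_toNat (ne_top_of_le_ne_top (hfin n)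
        (length_submodule_mono (inf_le_inf_right _ h)))).symm
    have key := length_gcomp_add_length_gcomp 𝒜 ℳ hN hN' hx n
    rw [← hK, ← hC, hfin' N hW, hfin' N' (hle.trans hW), hfin' K (inf_le_left.trans hW),
      hfin' C (hCN.trans hW)] at key
    have key' : (hilb ℳ N n : ℚ) + hilb ℳ N' (n + 1) = hilb ℳ K n + hilb ℳ C (n + 1) := by
      exact_mod_cast key
    linarith

/-- The Hilbert function of a graded submodule is eventually polynomial. -/
lemma eventuallyPoly_hilb [GradedAlgebra 𝒜] (hstd : ∀ n, 𝒜 n = 𝒜 1 ^ n) [IsNoetherianRing G]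
    [IsNoetherian G L] {W : Submodule G L} (hfin : ∀ n, Module.length R (gcomp ℳ W n) ≠ ⊤)
    (hW : IsHomog ℳ W) : EventuallyPoly (fun n => (hilb ℳ W n : ℚ)) := by
  have h0 : 𝒜 0 = 1 := by rw [hstd, pow_zero]
  have := isNoetherian_component 𝒜 𝒜 h0 1
  obtain ⟨T, hT⟩ := (Module.Finite.iff_fg.mp (inferInstance : Module.Finite R (𝒜 1)))
  have := eventuallyPoly_hilb_sub 𝒜 ℳ hstd hfin T
    (fun a ha => by rw [← hT]; exact Submodule.subset_span ha) ⊥ W ⊥ (by rw [hT]; exact le_sup_right)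
    (by simp) hW (fun n x hx => by simp [(Submodule.mem_bot G).mp hx]) bot_le le_rfl
  have hb : ∀ n, hilb ℳ (⊥ : Submodule G L) n = 0 := by
    intro n
    have : gcomp ℳ (⊥ : Submodule G L) n = ⊥ := eq_bot_iff.mpr fun x hx => by simpa using hx.1
    rw [hilb, this, Module.length_bot]
    rfl
  simpa [hb] using this

end HilbertSerre

section Asymptotics

open Polynomial Topology

variable {H : ℕ → ℕ} {Q : ℝ[X]}

lemma tendsto_div_pow_of_degree_lt (hQ : ∀ᶠ n : ℕ in atTop, (H n : ℝ) = Q.eval (n : ℝ)) {e : ℕ}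
    (he : Q.degree < e) : Tendsto (fun n : ℕ => (H n : ℝ) / (n : ℝ) ^ e) atTop (𝓝 0) := by
  have h := (Polynomial.div_tendsto_atTop_zero_of_degree_lt Q (X ^ e)
    (by rwa [degree_X_pow])).comp tendsto_natCast_atTop_atTop
  refine h.congr' ?_
  filter_upwards [hQ] with n hn
  simp [hn]

lemma tendsto_div_pow_of_degree_eq (hQ : ∀ᶠ n : ℕ in atTop, (H n : ℝ) = Q.eval (n : ℝ)) {e : ℕ}
    (he : Q.degree = e) :
    Tendsto (fun n : ℕ => (H n : ℝ) / (n : ℝ) ^ e) atTop (𝓝 Q.leadingCoeff) := by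
  have h := (Polynomial.div_tendsto_atTop_leadingCoeff_div_of_degree_eq Q (X ^ e)
    (by rwa [degree_X_pow])).comp tendsto_natCast_atTop_atTop
  rw [leadingCoeff_X_pow, div_one] at h
  refine h.congr' ?_
  filter_upwards [hQ] with n hn
  simp [hn]

lemma degree_lt_of_sum_le (hQ : ∀ᶠ n : ℕ in atTop, (H n : ℝ) = Q.eval (n : ℝ)) {e C : ℕ}
    (hC : ∀ n, ∑ i ∈ Finset.range (n + 1), H i ≤ C * (n + 1) ^ e) : Q.degree < e := by
  by_contra! hlt
  have hQ0 : Q ≠ 0 := by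
    rintro rfl
    simp at hlt
  have hdeg := degree_eq_natDegree hQ0
  set p := Q.natDegree
  have hep : e ≤ p := by rw [hdeg] at hlt; exact_mod_cast hlt
  have ht := tendsto_div_pow_of_degree_eq hQ hdeg
  have hpos : 0 < Q.leadingCoeff :=
    lt_of_le_of_ne (ge_of_tendsto' ht fun n => by positivity) (leadingCoeff_ne_zero.mpr hQ0).symm
  set l := Q.leadingCoeff
  obtain ⟨N, hN⟩ := eventually_atTop.mp (ht.eventually (lt_mem_nhds (half_lt_self hpos)))
  obtain ⟨m, hm⟩ := exists_nat_gt (C * 3 ^ p / (l / 2))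
  set n := max (max N m) 1 with hn
  have hnN : N ≤ n := by omega
  have hnm : m ≤ n := by omega
  have hn1 : 1 ≤ n := by omega
  have hn1' : (1 : ℝ) ≤ n := by exact_mod_cast hn1
  have h1 : (n : ℝ) * (l / 2 * (n : ℝ) ^ p) ≤ ∑ i ∈ Finset.range (2 * n + 1), (H i : ℝ) := by
    calc (n : ℝ) * (l / 2 * (n : ℝ) ^ p) = ∑ i ∈ Finset.Ico n (2 * n), l / 2 * (n : ℝ) ^ p := by
          rw [Finset.sum_const, Nat.card_Ico, nsmul_eq_mul]
          congr 2
          omega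
      _ ≤ ∑ i ∈ Finset.Ico n (2 * n), (H i : ℝ) := by
          refine Finset.sum_le_sum fun i hi => ?_
          rw [Finset.mem_Ico] at hi
          have hni : (n : ℝ) ≤ i := by exact_mod_cast hi.1
          have := hN i (by omega)
          have hi0 : (0 : ℝ) < i := by linarith
          rw [lt_div_iff₀ (by positivity)] at this
          refine le_trans ?_ this.le
          gcongr
      _ ≤ _ := by
          refine Finset.sum_le_sum_of_subset_of_nonneg ?_ fun _ _ _ => by positivity
          intro i hi
          rw [Finset.mem_Ico] at hi
          rw [Finset.mem_range]
          omega
  have h2 : ∑ i ∈ Finset.range (2 * n + 1), (H i : ℝ) ≤ C * (3 ^ p * (n : ℝ) ^ p) := by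
    have h3 : ((∑ i ∈ Finset.range (2 * n + 1), H i : ℕ) : ℝ) ≤ C * (2 * n + 1) ^ e := by
      exact_mod_cast hC (2 * n)
    push_cast at h3
    refine h3.trans ?_
    rw [← mul_pow]
    have : (2 * n + 1 : ℝ) ^ e ≤ (2 * n + 1 : ℝ) ^ p :=
      pow_le_pow_right₀ (by linarith) hep
    have h4 : (2 * n + 1 : ℝ) ^ p ≤ (3 * n : ℝ) ^ p := by
      gcongr
      linarith
    gcongr
    exact this.trans h4
  have h5 : (n : ℝ) * (l / 2) ≤ C * 3 ^ p := by
    have : 0 < (n : ℝ) ^ p := by positivity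
    refine le_of_mul_le_mul_right ?_ this
    linarith [h1.trans h2]
  have h6 : C * 3 ^ p / (l / 2) < n := hm.trans_le (by exact_mod_cast hnm)
  rw [div_lt_iff₀ (by positivity)] at h6
  linarith

lemma not_degree_lt_of_pow_le_sum (hQ : ∀ᶠ n : ℕ in atTop, (H n : ℝ) = Q.eval (n : ℝ))
    {e A c : ℕ} (hA : ∀ t, t ^ (e + 1) ≤ ∑ i ∈ Finset.range (A * t + c + 1), H i) :
    ¬ Q.degree < e := by
  intro hlt
  have hu : Tendsto (fun n : ℕ => (H n : ℝ) / ((n : ℝ) + 1) ^ e) atTop (𝓝 0) := by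
    refine squeeze_zero' (Eventually.of_forall fun n => by positivity) ?_
      (tendsto_div_pow_of_degree_lt hQ hlt)
    filter_upwards [eventually_gt_atTop 0] with n hn
    have : (0 : ℝ) < n := by exact_mod_cast hn
    gcongr
    linarith
  have hces := hu.cesaro
  have hA' : ∀ t : ℕ, 1 ≤ t → t ≤ A * t + c + 1 := by
    intro t ht
    rcases Nat.eq_zero_or_pos A with rfl | h
    · by_contra! hlt
      have h1 := fun s => hA s
      simp only [zero_mul, zero_add] at h1
      set S := ∑ i ∈ Finset.range (c + 1), H i
      have := (Nat.le_self_pow (by omega : e + 1 ≠ 0) (S + 1)).trans (h1 (S + 1))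
      omega
    · nlinarith
  set δ : ℝ := 1 / (A + c + 1) with hδ
  have hδ0 : 0 < δ := by positivity
  have hev := hces.eventually (gt_mem_nhds (show (0 : ℝ) < δ ^ (e + 1) by positivity))
  obtain ⟨N, hN⟩ := eventually_atTop.mp hev
  set t := max N 1 with ht
  have ht1 : 1 ≤ t := by omega
  have ht1' : (1 : ℝ) ≤ t := by exact_mod_cast ht1
  set n := A * t + c + 1 with hn
  have hNn := hN n (by have := hA' t ht1; omega)
  have hnpos : (0 : ℝ) < n := by rw [hn]; positivity
  have hsum : (t : ℝ) ^ (e + 1) ≤ (n : ℝ) ^ e *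
      ∑ i ∈ Finset.range n, (H i : ℝ) / ((i : ℝ) + 1) ^ e := by
    calc (t : ℝ) ^ (e + 1) ≤ ∑ i ∈ Finset.range n, (H i : ℝ) := by exact_mod_cast hA t
      _ ≤ _ := by
        rw [Finset.mul_sum]
        refine Finset.sum_le_sum fun i hi => ?_
        rw [Finset.mem_range] at hi
        have : (i : ℝ) + 1 ≤ n := by exact_mod_cast hi
        rw [mul_div_assoc', le_div_iff₀ (by positivity), mul_comm]
        gcongr
  have hδn : δ * n ≤ t := by
    rw [hδ, div_mul_eq_mul_div, one_mul, div_le_iff₀ (by positivity), hn]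
    push_cast
    nlinarith [(Nat.cast_nonneg c : (0 : ℝ) ≤ c)]
  have h1 : (δ * n) ^ (e + 1) ≤ (t : ℝ) ^ (e + 1) := by gcongr
  rw [inv_mul_eq_div, div_lt_iff₀ hnpos] at hNn
  have h2 := h1.trans hsum
  rw [mul_pow, pow_succ (n : ℝ)] at h2
  have : 0 < (n : ℝ) ^ e := by positivity
  nlinarith

lemma EventuallyPoly.exists_real (hH : EventuallyPoly fun n => (H n : ℚ)) :
    ∃ Q : ℝ[X], ∀ᶠ n : ℕ in atTop, (H n : ℝ) = Q.eval (n : ℝ) := by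
  obtain ⟨P, hP⟩ := hH
  refine ⟨P.map (algebraMap ℚ ℝ), hP.mono fun n hn => ?_⟩
  have : ((n : ℝ)) = algebraMap ℚ ℝ (n : ℚ) := by simp
  rw [this, eval_map_algebraMap, aeval_algebraMap_apply, coe_aeval_eq_eval, ← hn]
  simp

lemma limUnder_eq_zero_of_sum_le (hH : EventuallyPoly fun n => (H n : ℚ)) {e C : ℕ}
    (hC : ∀ n, ∑ i ∈ Finset.range (n + 1), H i ≤ C * (n + 1) ^ e) :
    limUnder atTop (fun n : ℕ => (e.factorial : ℝ) / (n : ℝ) ^ e * (H n : ℝ)) = 0 := by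
  obtain ⟨Q, hQ⟩ := hH.exists_real
  have := (tendsto_div_pow_of_degree_lt hQ (degree_lt_of_sum_le hQ hC)).const_mul (e.factorial : ℝ)
  rw [mul_zero] at this
  refine Tendsto.limUnder_eq (this.congr fun n => ?_)
  ring

lemma limUnder_ne_zero_of_pow_le_sum (hH : EventuallyPoly fun n => (H n : ℚ)) {e A c C : ℕ}
    (hC : ∀ n, ∑ i ∈ Finset.range (n + 1), H i ≤ C * (n + 1) ^ (e + 1))
    (hA : ∀ t, t ^ (e + 1) ≤ ∑ i ∈ Finset.range (A * t + c + 1), H i) :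
    limUnder atTop (fun n : ℕ => (e.factorial : ℝ) / (n : ℝ) ^ e * (H n : ℝ)) ≠ 0 := by
  obtain ⟨Q, hQ⟩ := hH.exists_real
  have h1 := degree_lt_of_sum_le hQ hC
  have h2 := not_degree_lt_of_pow_le_sum hQ hA
  have hQ0 : Q ≠ 0 := by
    rintro rfl
    exact h2 (by simp)
  have hdeg : Q.degree = e := by
    rw [degree_eq_natDegree hQ0] at *
    norm_cast at *
    omega
  have := (tendsto_div_pow_of_degree_eq hQ hdeg).const_mul (e.factorial : ℝ)
  rw [Tendsto.limUnder_eq (this.congr fun n => by ring)]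
  exact mul_ne_zero (by positivity) (leadingCoeff_ne_zero.mpr hQ0)

end Asymptotics

section LengthBounds

variable {R : Type*} [CommRing R] {M : Type*} [AddCommGroup M] [Module R M]

lemma length_sup_le (A B : Submodule R M) :
    Module.length R (A ⊔ B : Submodule R M) ≤ Module.length R A + Module.length R B := by
  rw [← Module.length_prod]
  refine Module.length_le_of_surjective
    ((A.subtype.coprod B.subtype).codRestrict (A ⊔ B) fun x =>
      Submodule.add_mem_sup x.1.2 x.2.2) ?_
  rintro ⟨x, hx⟩
  obtain ⟨y, hy, z, hz, rfl⟩ := Submodule.mem_sup.mp hx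
  exact ⟨(⟨y, hy⟩, ⟨z, hz⟩), rfl⟩

lemma length_span_singleton_le (a : Ideal R) {x : M} (hx : ∀ r ∈ a, r • x = 0) :
    Module.length R (Submodule.span R {x}) ≤ Module.length R (R ⧸ a) := by
  refine Module.length_le_of_surjective
    (Submodule.liftQ a ((LinearMap.toSpanSingleton R M x).codRestrict (Submodule.span R {x})
      fun r => Submodule.mem_span_singleton.mpr ⟨r, rfl⟩) fun r hr => Subtype.ext (hx r hr)) ?_
  rintro ⟨y, hy⟩
  obtain ⟨r, rfl⟩ := Submodule.mem_span_singleton.mp hy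
  exact ⟨Submodule.Quotient.mk r, rfl⟩

lemma length_span_le (a : Ideal R) (s : Finset M) (hs : ∀ x ∈ s, ∀ r ∈ a, r • x = 0) :
    Module.length R (Submodule.span R (s : Set M)) ≤ s.card * Module.length R (R ⧸ a) := by
  classical
  induction s using Finset.induction_on with
  | empty =>
    rw [Finset.coe_empty, Submodule.span_empty, Module.length_bot]
    exact zero_le
  | insert x s hx ih =>
    rw [Finset.coe_insert, Submodule.span_insert, Finset.card_insert_of_notMem hx]
    refine (length_sup_le _ _).trans ?_
    push_cast
    rw [add_mul, one_mul, add_comm]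
    exact add_le_add (ih fun y hy => hs y (Finset.mem_insert_of_mem hy))
      (length_span_singleton_le a (hs x (Finset.mem_insert_self _ _)))

lemma length_quotient_maximalIdeal_pow_ne_top [IsNoetherianRing R] [IsLocalRing R] (n : ℕ) :
    Module.length R (R ⧸ IsLocalRing.maximalIdeal R ^ n) ≠ ⊤ := by
  have : IsArtinianRing (R ⧸ IsLocalRing.maximalIdeal R ^ n) := by
    by_cases hn : n = 0
    · subst hn
      rw [pow_zero, Ideal.one_eq_top]
      infer_instance
    have : IsLocalRing (R ⧸ IsLocalRing.maximalIdeal R ^ n) := by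
      have : Nontrivial (R ⧸ IsLocalRing.maximalIdeal R ^ n) :=
        Ideal.Quotient.nontrivial_iff.mpr fun h => Ideal.IsPrime.ne_top'
          (top_le_iff.mp (h.symm.le.trans (Ideal.pow_le_self hn)))
      exact IsLocalRing.of_surjective' _ Ideal.Quotient.mk_surjective
    rw [isArtinianRing_iff_isNilpotent_maximalIdeal]
    have h : IsLocalRing.maximalIdeal (R ⧸ IsLocalRing.maximalIdeal R ^ n) ≤
        (IsLocalRing.maximalIdeal R).map (Ideal.Quotient.mk _) := by
      intro x hx
      obtain ⟨r, rfl⟩ := Ideal.Quotient.mk_surjective x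
      refine Ideal.mem_map_of_mem _ ?_
      rw [IsLocalRing.mem_maximalIdeal] at hx ⊢
      exact fun hr => hx (hr.map _)
    refine ⟨n, le_bot_iff.mp ((Ideal.pow_right_mono h n).trans ?_)⟩
    rw [← Ideal.map_pow, Ideal.map_quotient_self]
  rw [Module.length_eq_of_surjective (S := R) (R := R ⧸ IsLocalRing.maximalIdeal R ^ n)
    (M := R ⧸ IsLocalRing.maximalIdeal R ^ n) Ideal.Quotient.mk_surjective]
  exact Module.length_ne_top

end LengthBounds

section Torsion

variable {R G : Type*} [CommRing R] [CommRing G] [Algebra R G] (𝒜 : ℕ → Submodule R G)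
  {L : Type*} [AddCommGroup L] [Module R L] [Module G L] [IsScalarTower R G L]
  (ℳ : ℕ → Submodule R L) [DirectSum.Decomposition ℳ]

/-- The elements of `W` concentrated in degrees less than `n`. -/
def trunc (W : Submodule G L) (n : ℕ) : Submodule R L :=
  W.restrictScalars R ⊓ ⨅ i ≥ n, LinearMap.ker (gproj ℳ i)

lemma mem_trunc {W : Submodule G L} {n : ℕ} {x : L} :
    x ∈ trunc ℳ W n ↔ x ∈ W ∧ ∀ i ≥ n, gproj ℳ i x = 0 := by
  simp [trunc]

lemma length_trunc {W : Submodule G L} (hW : IsHomog ℳ W) (n : ℕ) :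
    Module.length R (trunc ℳ W n) = ∑ i ∈ Finset.range n, Module.length R (gcomp ℳ W i) := by
  induction n with
  | zero =>
    have : trunc ℳ W 0 = ⊥ := by
      refine (Submodule.eq_bot_iff _).mpr fun x hx => ?_
      obtain ⟨s, hs⟩ := exists_sum_gproj ℳ x
      rw [hs]
      exact Finset.sum_eq_zero fun i _ => ((mem_trunc ℳ).mp hx).2 i (Nat.zero_le _)
    rw [this]
    simp
  | succ n ih =>
    rw [Finset.sum_range_succ, ← ih, length_eq_inf_ker_add_map _ (gproj ℳ n)]
    have h1 : trunc ℳ W (n + 1) ⊓ LinearMap.ker (gproj ℳ n) = trunc ℳ W n := by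
      ext x
      simp only [Submodule.mem_inf, mem_trunc, LinearMap.mem_ker]
      constructor
      · rintro ⟨⟨h1, h2⟩, h3⟩
        refine ⟨h1, fun i hi => ?_⟩
        rcases hi.eq_or_lt with rfl | hi
        · exact h3
        · exact h2 i hi
      · rintro ⟨h1, h2⟩
        exact ⟨⟨h1, fun i hi => h2 i (by omega)⟩, h2 n le_rfl⟩
    have h2 : (trunc ℳ W (n + 1)).map (gproj ℳ n) = gcomp ℳ W n := by
      apply le_antisymm
      · rintro _ ⟨x, hx, rfl⟩
        exact ⟨hW n x ((mem_trunc ℳ).mp hx).1, gproj_mem ℳ n x⟩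
      · rintro x ⟨h1, h2⟩
        refine ⟨x, (mem_trunc ℳ).mpr ⟨h1, fun i hi => ?_⟩, gproj_of_mem ℳ h2⟩
        exact gproj_of_mem_ne ℳ h2 (by omega)
    rw [h1, h2]

lemma trunc_mono (W : Submodule G L) {m n : ℕ} (h : m ≤ n) : trunc ℳ W m ≤ trunc ℳ W n :=
  fun _ hx => (mem_trunc ℳ).mpr ⟨((mem_trunc ℳ).mp hx).1, fun i hi =>
    ((mem_trunc ℳ).mp hx).2 i (h.trans hi)⟩

lemma exists_mem_trunc {W : Submodule G L} {x : L} (hx : x ∈ W) : ∃ n, x ∈ trunc ℳ W n := by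
  obtain ⟨s, hs⟩ := exists_sum_gproj ℳ x
  refine ⟨s.sup id + 1, (mem_trunc ℳ).mpr ⟨hx, fun i hi => ?_⟩⟩
  rw [hs, map_sum]
  refine Finset.sum_eq_zero fun j hj => gproj_of_mem_ne ℳ (gproj_mem ℳ j x) ?_
  have : j ≤ s.sup id := Finset.le_sup (f := id) hj
  omega

lemma smul_mem_trunc [GradedAlgebra 𝒜] [SetLike.GradedSMul 𝒜 ℳ] {W : Submodule G L} {m n : ℕ}
    {a : G} (ha : a ∈ trunc 𝒜 (⊤ : Ideal G) (m + 1)) {x : L} (hx : x ∈ trunc ℳ W n) :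
    a • x ∈ trunc ℳ W (m + n) := by
  rw [mem_trunc] at *
  refine ⟨W.smul_mem a hx.1, fun i hi => ?_⟩
  obtain ⟨s, hs⟩ := exists_sum_gproj 𝒜 a
  rw [hs, Finset.sum_smul, map_sum]
  refine Finset.sum_eq_zero fun j _ => ?_
  rcases lt_or_ge m j with h | h
  · rw [ha.2 j h, zero_smul, map_zero]
  · obtain ⟨k, rfl⟩ := Nat.exists_eq_add_of_le (show j ≤ i by omega)
    rw [gproj_smul_add 𝒜 ℳ (gproj_mem 𝒜 j a), hx.2 k (by omega), smul_zero]

lemma exists_H0_eq_torsionBySet (J : Ideal G) [IsNoetherian G L] :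
    ∃ K, H0 J L = Submodule.torsionBySet G L ((J ^ K : Ideal G) : Set G) := by
  let F : ℕ →o Submodule G L := ⟨fun n => Submodule.torsionBySet G L ((J ^ n : Ideal G) : Set G),
    fun m n h => Submodule.torsionBySet_le_torsionBySet_of_subset (Ideal.pow_le_pow_right h)⟩
  obtain ⟨K, hK⟩ := monotone_stabilizes_iff_noetherian.mpr ‹IsNoetherian G L› F
  refine ⟨K, le_antisymm (iSup_le fun n => ?_) (le_iSup (fun n => F n) K)⟩
  rcases le_total n K with h | h
  · exact F.monotone h
  · exact (hK n h).ge

lemma mem_torsionBySet_map_iff (a : Ideal R) (x : L) :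
    x ∈ Submodule.torsionBySet G L ((a.map (algebraMap R G) : Ideal G) : Set G) ↔
      ∀ r ∈ a, r • x = 0 := by
  rw [Submodule.mem_torsionBySet_iff]
  constructor
  · intro h r hr
    rw [← algebraMap_smul G r x]
    exact h ⟨_, Ideal.mem_map_of_mem _ hr⟩
  · rintro h ⟨g, hg⟩
    change g • x = 0
    induction hg using Submodule.span_induction with
    | mem y hy =>
      obtain ⟨r, hr, rfl⟩ := hy
      rw [algebraMap_smul]
      exact h r hr
    | zero => simp
    | add y z _ _ hy hz => rw [add_smul, hy, hz, add_zero]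
    | smul b y _ hy => rw [smul_eq_mul, mul_smul, hy, smul_zero]

lemma exists_mem_H0_map_iff (a : Ideal R) [IsNoetherian G L] :
    ∃ K, ∀ x, x ∈ H0 (a.map (algebraMap R G)) L ↔ ∀ r ∈ a ^ K, r • x = 0 := by
  obtain ⟨K, hK⟩ := exists_H0_eq_torsionBySet (L := L) (a.map (algebraMap R G))
  refine ⟨K, fun x => ?_⟩
  rw [hK, ← Ideal.map_pow, mem_torsionBySet_map_iff]

lemma isHomog_H0 (a : Ideal R) [IsNoetherian G L] :
    IsHomog ℳ (H0 (a.map (algebraMap R G)) L) := by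
  obtain ⟨K, hK⟩ := exists_mem_H0_map_iff (L := L) (G := G) a
  intro n x hx
  rw [hK] at *
  intro r hr
  rw [← map_smul, hx r hr, map_zero]

lemma exists_finset_span_gcomp [GradedAlgebra 𝒜] [SetLike.GradedSMul 𝒜 ℳ] (h0 : 𝒜 0 = 1)
    [IsNoetherian G L] (W : Submodule G L) (n : ℕ) :
    ∃ s : Finset L, Submodule.span R (s : Set L) = gcomp ℳ W n := by
  have := isNoetherian_component 𝒜 ℳ h0 n
  have h : (gcomp ℳ W n).FG := by
    have h1 : ((gcomp ℳ W n).comap (ℳ n).subtype).FG := IsNoetherian.noetherian _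
    have h2 := h1.map (ℳ n).subtype
    rwa [Submodule.map_comap_subtype, inf_eq_right.mpr inf_le_right] at h2
  exact h

lemma length_gcomp_H0_ne_top [IsNoetherianRing R] [IsLocalRing R] [GradedAlgebra 𝒜]
    [SetLike.GradedSMul 𝒜 ℳ] (h0 : 𝒜 0 = 1) [IsNoetherian G L] (n : ℕ) :
    Module.length R (gcomp ℳ
      (H0 ((IsLocalRing.maximalIdeal R).map (algebraMap R G)) L) n) ≠ ⊤ := by
  obtain ⟨K, hK⟩ := exists_mem_H0_map_iff (L := L) (G := G) (IsLocalRing.maximalIdeal R)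
  obtain ⟨s, hs⟩ := exists_finset_span_gcomp 𝒜 ℳ h0
    (H0 ((IsLocalRing.maximalIdeal R).map (algebraMap R G)) L) n
  rw [← hs]
  refine ne_top_of_le_ne_top ?_ (length_span_le (IsLocalRing.maximalIdeal R ^ K) s fun x hx => ?_)
  · exact WithTop.mul_ne_top (ENat.natCast_ne_top _) (length_quotient_maximalIdeal_pow_ne_top K)
  · refine (hK x).mp ?_
    have : x ∈ gcomp ℳ (H0 ((IsLocalRing.maximalIdeal R).map (algebraMap R G)) L) n :=
      hs ▸ Submodule.subset_span hx
    exact this.1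

end Torsion

section Dimension

lemma ringKrullDim_eq_of_injective_of_isIntegral {A B : Type*} [CommRing A] [CommRing B]
    (f : A →+* B) (hf : Function.Injective f) (hi : f.IsIntegral) :
    ringKrullDim B = ringKrullDim A := by
  algebraize [f]
  have : Algebra.IsIntegral A B := ⟨hi⟩
  have : FaithfulSMul A B := (faithfulSMul_iff_algebraMap_injective A B).mpr hf
  apply le_antisymm
  · refine Order.krullDim_le_of_strictMono (PrimeSpectrum.comap (algebraMap A B)) fun p q h => ?_
    exact Ideal.IsIntegral.comap_lt_comap (R := A) h
  · refine iSup_le fun l => ?_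
    obtain ⟨⟨Q, hQ, hl⟩⟩ := Ideal.nonempty_primesOver (S := B) l.head.asIdeal
    obtain ⟨l', h, -⟩ := Ideal.exists_ltSeries_of_hasGoingUp l Q
    rw [← h]
    exact Order.LTSeries.length_le_krullDim l'

lemma exists_noether_normalization (k B : Type*) [Field k] [CommRing B] [Nontrivial B]
    [Algebra k B] [Algebra.FiniteType k B] :
    ∃ s : ℕ, ∃ g : MvPolynomial (Fin s) k →ₐ[k] B, Function.Injective g ∧ g.IsIntegral ∧
      ringKrullDim B = s := by
  obtain ⟨s, g, hg, hi⟩ := exists_integral_inj_algHom_of_fg k B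
  refine ⟨s, g, hg, hi, ?_⟩
  rw [ringKrullDim_eq_of_injective_of_isIntegral g.toRingHom hg hi]
  simp

/-- Noether normalization for an algebra over a local ring which is annihilated by the maximal
ideal. -/
lemma exists_noether_normalization_of_isLocalRing (R : Type*) {B : Type*} [CommRing R]
    [IsLocalRing R] [CommRing B] [Nontrivial B] [Algebra R B] [Algebra.FiniteType R B]
    (hB : ∀ r ∈ IsLocalRing.maximalIdeal R, algebraMap R B r = 0) :
    ∃ (s : ℕ) (y : Fin s → B), ringKrullDim B = s ∧
      (MvPolynomial.aeval y : MvPolynomial (Fin s) R →ₐ[R] B).toRingHom.IsIntegral ∧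
      ∀ p : MvPolynomial (Fin s) R, MvPolynomial.aeval y p = 0 →
        ∀ m, p.coeff m ∈ IsLocalRing.maximalIdeal R := by
  let k := IsLocalRing.ResidueField R
  let f : k →+* B := Ideal.Quotient.lift _ (algebraMap R B) hB
  let _ : Algebra k B := f.toAlgebra
  have : IsScalarTower R k B := IsScalarTower.of_algebraMap_eq fun r => rfl
  have : Algebra.FiniteType k B := Algebra.FiniteType.of_restrictScalars_finiteType R k B
  obtain ⟨s, g, hg, hi, hs⟩ := exists_noether_normalization k B
  have hcomp : (MvPolynomial.aeval (fun i => g (MvPolynomial.X i)) :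
      MvPolynomial (Fin s) R →ₐ[R] B).toRingHom =
      g.toRingHom.comp (MvPolynomial.map (algebraMap R k)) := by
    refine MvPolynomial.ringHom_ext (fun r => ?_) fun i => ?_
    · simp [IsScalarTower.algebraMap_apply R k B]
    · simp
  refine ⟨s, fun i => g (MvPolynomial.X i), hs, ?_, fun p hp m => ?_⟩
  · rw [hcomp]
    exact RingHom.IsIntegral.trans _ _ (RingHom.isIntegral_of_surjective _
      (MvPolynomial.map_surjective _ IsLocalRing.residue_surjective)) hi
  · have h1 : g (MvPolynomial.map (algebraMap R k) p) = 0 := by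
      rw [← hp]
      exact (congrArg (fun F : MvPolynomial (Fin s) R →+* B => F p) hcomp).symm
    have h2 : MvPolynomial.map (algebraMap R k) p = 0 := hg (h1.trans (map_zero g).symm)
    rw [← IsLocalRing.residue_eq_zero_iff]
    have h3 := congrArg (MvPolynomial.coeff m) h2
    rwa [MvPolynomial.coeff_map, MvPolynomial.coeff_zero] at h3

/-- If passing to a larger ideal preserves the maximal dimension, then some minimal prime of the
smaller ideal contains the larger one and has full dimension. -/
lemma exists_mem_minimalPrimes_of_le_ringKrullDim {A : Type*} [CommRing A] {I J : Ideal A}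
    (h : J ≤ I) {d : ℕ} (hJ : ringKrullDim (A ⧸ J) ≤ d) (hI : (d : WithBot ℕ∞) ≤ ringKrullDim (A ⧸ I)) :
    ∃ P ∈ J.minimalPrimes, I ≤ P ∧ (d : WithBot ℕ∞) ≤ ringKrullDim (A ⧸ P) := by
  rw [ringKrullDim_quotient, Order.le_krullDim_iff] at hI
  obtain ⟨l, hl⟩ := hI
  have hle : ∀ i, l.head.1 ≤ (l i).1 := fun i => l.head_le i
  refine ⟨l.head.1.asIdeal, ⟨⟨l.head.1.2, h.trans l.head.2⟩, fun Q hQ hQP => ?_⟩, l.head.2, ?_⟩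
  · by_contra hPQ
    let l' : LTSeries (PrimeSpectrum.zeroLocus (R := A) J) :=
      l.map (fun p => ⟨p.1, fun x hx => p.2 (h hx)⟩) fun p q hpq => hpq
    let l'' := l'.cons ⟨⟨Q, hQ.1⟩, hQ.2⟩ (show Q < l.head.1.asIdeal from lt_of_le_not_ge hQP hPQ)
    have h1 := Order.LTSeries.length_le_krullDim l''
    rw [← ringKrullDim_quotient] at h1
    have h2 : l''.length = d + 1 := by
      rw [← hl, show l.length = l'.length from rfl]
      exact RelSeries.cons_length _ _ _
    rw [h2] at h1
    have := h1.trans hJ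
    norm_cast at this
    omega
  · rw [ringKrullDim_quotient, Order.le_krullDim_iff]
    exact ⟨⟨l.length, fun i => ⟨(l i).1, hle i⟩, l.step⟩, hl⟩

end Dimension

section LowerBound

variable {R G : Type*} [CommRing R] [CommRing G] [Algebra R G] (𝒜 : ℕ → Submodule R G)
  {L : Type*} [AddCommGroup L] [Module R L] [Module G L] [IsScalarTower R G L]
  (ℳ : ℕ → Submodule R L) [DirectSum.Decomposition ℳ]

lemma finiteType_of_standard [GradedAlgebra 𝒜] (hstd : ∀ n, 𝒜 n = 𝒜 1 ^ n) [IsNoetherianRing G] :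
    Algebra.FiniteType R G := by
  have h0 : 𝒜 0 = 1 := by rw [hstd, pow_zero]
  obtain ⟨s, hs⟩ := exists_finset_span_gcomp 𝒜 𝒜 h0 (⊤ : Ideal G) 1
  have h1 : 𝒜 1 ≤ Subalgebra.toSubmodule (Algebra.adjoin R (s : Set G)) := by
    refine le_trans ?_ (hs.symm.le.trans ?_)
    · exact fun x hx => ⟨trivial, hx⟩
    · exact Submodule.span_le.mpr Algebra.subset_adjoin
  refine ⟨s, eq_top_iff.mpr fun x _ => ?_⟩
  induction x using graded_induction 𝒜 with
  | h0 => exact zero_mem _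
  | hadd a b ha hb => exact add_mem (ha trivial) (hb trivial)
  | h n a ha =>
    rw [hstd n] at ha
    have h2 : ∀ n, 𝒜 1 ^ n ≤ Subalgebra.toSubmodule (Algebra.adjoin R (s : Set G)) := by
      intro n
      induction n with
      | zero =>
        rw [pow_zero, Submodule.one_le]
        exact (Algebra.adjoin R (s : Set G)).one_mem
      | succ n ih =>
        rw [pow_succ, Submodule.mul_le]
        exact fun x hx y hy => mul_mem (S := Subalgebra R G) (ih hx) (h1 hy)
    exact h2 n ha

lemma one_mem_trunc [GradedAlgebra 𝒜] : (1 : G) ∈ trunc 𝒜 (⊤ : Ideal G) 1 :=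
  (mem_trunc 𝒜).mpr ⟨trivial, fun _ hi =>
    gproj_of_mem_ne 𝒜 (SetLike.GradedOne.one_mem (A := 𝒜)) (by omega)⟩

lemma pow_mem_trunc [GradedAlgebra 𝒜] {D : ℕ} {a : G} (ha : a ∈ trunc 𝒜 (⊤ : Ideal G) (D + 1))
    (n : ℕ) : a ^ n ∈ trunc 𝒜 (⊤ : Ideal G) (D * n + 1) := by
  induction n with
  | zero => simpa using one_mem_trunc 𝒜
  | succ n ih =>
    rw [pow_succ', show D * (n + 1) + 1 = D + (D * n + 1) by ring]
    exact smul_mem_trunc 𝒜 𝒜 ha ih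

lemma prod_pow_mem_trunc [GradedAlgebra 𝒜] {ι : Type*} (s : Finset ι) {D : ℕ} {a : ι → G}
    (ha : ∀ i ∈ s, a i ∈ trunc 𝒜 (⊤ : Ideal G) (D + 1)) (m : ι → ℕ) :
    ∏ i ∈ s, a i ^ m i ∈ trunc 𝒜 (⊤ : Ideal G) (D * ∑ i ∈ s, m i + 1) := by
  classical
  induction s using Finset.induction_on with
  | empty => simpa using one_mem_trunc 𝒜
  | insert i s hi ih =>
    rw [Finset.prod_insert hi, Finset.sum_insert hi, mul_add, add_assoc]
    exact smul_mem_trunc 𝒜 𝒜 (pow_mem_trunc 𝒜 (ha i (Finset.mem_insert_self _ _)) _)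
      (ih fun j hj => ha j (Finset.mem_insert_of_mem hj))

lemma length_pi_residueField [IsLocalRing R] (ι : Type*) [Fintype ι] :
    Module.length R (ι → IsLocalRing.ResidueField R) = Fintype.card ι := by
  have : IsSimpleModule R (IsLocalRing.ResidueField R) :=
    isSimpleModule_iff_isCoatom.mpr (IsLocalRing.maximalIdeal.isMaximal R).out
  simp

/-- If the relations among finitely many elements all have coefficients in the maximal ideal, then
the length of the submodule they span is at least their number. -/
lemma card_le_length_of_forall_mem_maximalIdeal [IsLocalRing R] {ι : Type*} [Fintype ι] (v : ι → L)
    {N : Submodule R L} (hN : ∀ i, v i ∈ N)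
    (hv : ∀ c : ι → R, ∑ i, c i • v i = 0 → ∀ i, c i ∈ IsLocalRing.maximalIdeal R) :
    (Fintype.card ι : ℕ∞) ≤ Module.length R N := by
  let Ψ : (ι → R) →ₗ[R] L := Fintype.linearCombination R v
  let ρ : (ι → R) →ₗ[R] (ι → IsLocalRing.ResidueField R) :=
    LinearMap.pi fun i => (Algebra.linearMap R (IsLocalRing.ResidueField R)).comp (LinearMap.proj i)
  have hρ : LinearMap.ker Ψ ≤ LinearMap.ker ρ := fun c hc => by
    ext i
    exact (IsLocalRing.residue_eq_zero_iff _).mpr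
      (hv c (by simpa [Ψ, Fintype.linearCombination_apply] using hc) i)
  have hsurj : Function.Surjective (Submodule.liftQ _ ρ hρ) := by
    intro y
    choose c hc using fun i => IsLocalRing.residue_surjective (y i)
    exact ⟨Submodule.Quotient.mk c, funext hc⟩
  rw [← length_pi_residueField (R := R) ι]
  refine (Module.length_le_of_surjective _ hsurj).trans ?_
  rw [Ψ.quotKerEquivRange.length_eq]
  refine length_submodule_mono ?_
  rintro _ ⟨c, rfl⟩
  simp only [Ψ, Fintype.linearCombination_apply]
  exact sum_mem fun i _ => N.smul_mem _ (hN i)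

lemma sum_hilb_eq_length_trunc {W : Submodule G L} (hW : IsHomog ℳ W)
    (hfin : ∀ n, Module.length R (gcomp ℳ W n) ≠ ⊤) (n : ℕ) :
    ((∑ i ∈ Finset.range n, hilb ℳ W i : ℕ) : ℕ∞) = Module.length R (trunc ℳ W n) := by
  rw [length_trunc ℳ hW, Nat.cast_sum]
  exact Finset.sum_congr rfl fun i _ => ENat.natCast_toNat (hfin i)

lemma exists_pow_le_sum_hilb [IsLocalRing R] [GradedAlgebra 𝒜] [SetLike.GradedSMul 𝒜 ℳ]
    (hstd : ∀ n, 𝒜 n = 𝒜 1 ^ n) [IsNoetherianRing G] {W : Submodule G L} (hW : IsHomog ℳ W)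
    (hfin : ∀ n, Module.length R (gcomp ℳ W n) ≠ ⊤) {P : Ideal G} [P.IsPrime]
    (hP : (IsLocalRing.maximalIdeal R).map (algebraMap R G) ≤ P) {w : L} (hw : w ∈ W)
    (hPw : ∀ a : G, a • w = 0 → a ∈ P) {d : ℕ} (hd0 : 0 < d)
    (hd : (d : WithBot ℕ∞) ≤ ringKrullDim (G ⧸ P)) :
    ∃ A c, ∀ t, t ^ d ≤ ∑ i ∈ Finset.range (A * t + c + 1), hilb ℳ W i := by
  have := finiteType_of_standard 𝒜 hstd
  have : Algebra.FiniteType R (G ⧸ P) := this.of_surjective (Ideal.Quotient.mkₐ R P)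
    (Ideal.Quotient.mkₐ_surjective R P)
  obtain ⟨s, y, hs, -, hy⟩ := exists_noether_normalization_of_isLocalRing R (B := G ⧸ P)
    fun r hr => Ideal.Quotient.eq_zero_iff_mem.mpr (hP (Ideal.mem_map_of_mem _ hr))
  choose Y hY using fun i => Ideal.Quotient.mk_surjective (y i)
  have hds : d ≤ s := by
    rw [hs] at hd
    exact_mod_cast hd
  choose D hD using fun i => exists_mem_trunc 𝒜 (show Y i ∈ (⊤ : Ideal G) from trivial)
  have hD' : ∀ i ∈ Finset.univ, Y i ∈ trunc 𝒜 (⊤ : Ideal G) (Finset.univ.sup D + 1) := fun i hi =>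
    trunc_mono 𝒜 _ ((Finset.le_sup hi).trans (Nat.le_succ _)) (hD i)
  obtain ⟨c, hc⟩ := exists_mem_trunc ℳ hw
  refine ⟨Finset.univ.sup D * s, c, fun t => ?_⟩
  have key := card_le_length_of_forall_mem_maximalIdeal (R := R)
    (v := fun m : Fin s → Fin t => (∏ i, Y i ^ (m i : ℕ)) • w)
    (N := trunc ℳ W (Finset.univ.sup D * s * t + c + 1)) (fun m => ?_) fun b hb m => ?_
  · rw [← sum_hilb_eq_length_trunc ℳ hW hfin, Fintype.card_pi_const, Fintype.card_fin] at key
    refine le_trans ?_ (Nat.cast_le.mp key)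
    rcases t.eq_zero_or_pos with rfl | ht
    · rw [zero_pow hd0.ne']; exact Nat.zero_le _
    · exact Nat.pow_le_pow_right ht hds
  · refine trunc_mono ℳ W ?_ (smul_mem_trunc 𝒜 ℳ (prod_pow_mem_trunc 𝒜 _ hD' _) hc)
    have : ∑ i, (m i : ℕ) ≤ s * t := by
      refine (Finset.sum_le_card_nsmul _ _ t fun i _ => (m i).2.le).trans (by simp)
    have := Nat.mul_le_mul_left (Finset.univ.sup D) this
    rw [← mul_assoc] at this
    omega
  · let e : (Fin s → Fin t) → (Fin s →₀ ℕ) := fun m =>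
      Finsupp.equivFunOnFinite.symm fun i => (m i : ℕ)
    have he : Function.Injective e := fun m m' h => by
      ext i
      simpa [e] using DFunLike.congr_fun h i
    let p : MvPolynomial (Fin s) R := ∑ m, MvPolynomial.monomial (e m) (b m)
    have hp : p.coeff (e m) = b m := by
      classical
      simp only [p, MvPolynomial.coeff_sum, MvPolynomial.coeff_monomial, he.eq_iff]
      simp
    rw [← hp]
    refine hy p ?_ _
    have h1 : MvPolynomial.aeval y p = Ideal.Quotient.mk P (∑ m, b m • ∏ i, Y i ^ (m i : ℕ)) := by
      simp only [p, map_sum, MvPolynomial.aeval_monomial, Algebra.smul_def, map_mul, map_prod,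
        map_pow, hY]
      refine Finset.sum_congr rfl fun m _ => ?_
      rw [Finsupp.prod_fintype _ _ fun i => pow_zero _]
      rfl
    rw [h1, Ideal.Quotient.eq_zero_iff_mem]
    refine hPw _ ?_
    rw [← hb, Finset.sum_smul]
    exact Finset.sum_congr rfl fun m _ => smul_assoc _ _ _

end LowerBound

section UpperBound

variable {R G : Type*} [CommRing R] [CommRing G] [Algebra R G] (𝒜 : ℕ → Submodule R G)
  {L : Type*} [AddCommGroup L] [Module R L] [Module G L]

section PolySpan

variable {s : ℕ} {ι : Type*} (Y : Fin s → G) (u : ι → L)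

/-- The span of the products of the `u j` by polynomials of degree at most `m` in the `Y i`. -/
def polySpan (m : ℕ) : Submodule R L :=
  Submodule.span R {x | ∃ (j : ι) (p : MvPolynomial (Fin s) R), p.totalDegree ≤ m ∧
    x = MvPolynomial.aeval Y p • u j}

lemma polySpan_mono {m n : ℕ} (h : m ≤ n) : polySpan (R := R) Y u m ≤ polySpan Y u n :=
  Submodule.span_mono fun _ ⟨j, p, hp, hx⟩ => ⟨j, p, hp.trans h, hx⟩

lemma aeval_smul_mem_polySpan (p : MvPolynomial (Fin s) R) (j : ι) :
    MvPolynomial.aeval Y p • u j ∈ polySpan (R := R) Y u p.totalDegree :=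
  Submodule.subset_span ⟨j, p, le_rfl, rfl⟩

lemma exists_subset_polySpan {W : Submodule G L}
    (hu : ∀ x ∈ W, ∃ m, x ∈ polySpan (R := R) Y u m) (t : Finset L) (ht : ∀ x ∈ t, x ∈ W) :
    ∃ m, Submodule.span R (t : Set L) ≤ polySpan (R := R) Y u m := by
  choose! f hf using hu
  exact ⟨t.sup f, Submodule.span_le.mpr fun x hx =>
    polySpan_mono Y u (Finset.le_sup (f := f) hx) (hf x (ht x hx))⟩

variable [IsScalarTower R G L]

lemma aeval_smul_mem_polySpan_add {p : MvPolynomial (Fin s) R} {m n : ℕ} (hp : p.totalDegree ≤ m)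
    {x : L} (hx : x ∈ polySpan (R := R) Y u n) :
    MvPolynomial.aeval Y p • x ∈ polySpan (R := R) Y u (m + n) := by
  induction hx using Submodule.span_induction with
  | mem x h =>
    obtain ⟨j, q, hq, rfl⟩ := h
    refine Submodule.subset_span ⟨j, p * q, (MvPolynomial.totalDegree_mul _ _).trans
      (add_le_add hp hq), ?_⟩
    rw [map_mul, mul_smul]
  | zero => simp
  | add x y _ _ hx hy => rw [smul_add]; exact add_mem hx hy
  | smul r x _ hx =>
    rw [smul_comm]
    exact Submodule.smul_mem _ r hx

variable [Finite ι]

lemma exists_smul_mem_polySpan {W : Submodule G L} (huW : ∀ j, u j ∈ W)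
    (hu : ∀ x ∈ W, ∃ m, x ∈ polySpan (R := R) Y u m) (t : Finset G) :
    ∃ D, ∀ m, ∀ a ∈ Submodule.span R (t : Set G), ∀ x ∈ polySpan (R := R) Y u m,
      a • x ∈ polySpan (R := R) Y u (m + D) := by
  classical
  have := Fintype.ofFinite ι
  obtain ⟨D, hD⟩ := exists_subset_polySpan Y u hu
    ((t ×ˢ (Finset.univ : Finset ι)).image fun q => q.1 • u q.2) fun x hx => by
      obtain ⟨q, -, rfl⟩ := Finset.mem_image.mp hx
      exact W.smul_mem _ (huW _)
  refine ⟨D, fun m a ha x hx => ?_⟩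
  induction hx using Submodule.span_induction with
  | zero => simp
  | add x y _ _ hx hy => rw [smul_add]; exact add_mem hx hy
  | smul r x _ hx =>
    rw [smul_comm]
    exact Submodule.smul_mem _ r hx
  | mem x h =>
    obtain ⟨j, p, hp, rfl⟩ := h
    induction ha using Submodule.span_induction with
    | zero => simp
    | add x y _ _ hx hy => rw [add_smul]; exact add_mem hx hy
    | smul r x _ hx =>
      rw [smul_assoc]
      exact Submodule.smul_mem _ r hx
    | mem a ha =>
      rw [smul_comm]
      refine aeval_smul_mem_polySpan_add Y u hp (hD (Submodule.subset_span ?_))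
      exact Finset.mem_coe.mpr (Finset.mem_image.mpr
        ⟨(a, j), Finset.mem_product.mpr ⟨ha, Finset.mem_univ j⟩, rfl⟩)

lemma length_polySpan_le {a : Ideal R} (hu : ∀ j, ∀ r ∈ a, r • u j = 0) (m : ℕ) :
    Module.length R (polySpan (R := R) Y u m) ≤
      (Nat.card ι * (m + 1) ^ s : ℕ) * Module.length R (R ⧸ a) := by
  classical
  have := Fintype.ofFinite ι
  let F : ι × (Fin s → Fin (m + 1)) → L := fun q => (∏ i, Y i ^ (q.2 i : ℕ)) • u q.1
  have hle : polySpan (R := R) Y u m ≤ Submodule.span R (Finset.univ.image F : Set L) := by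
    refine Submodule.span_le.mpr ?_
    rintro _ ⟨j, p, hp, rfl⟩
    rw [SetLike.mem_coe, MvPolynomial.aeval_def, MvPolynomial.eval₂_eq', Finset.sum_smul]
    refine sum_mem fun e he => ?_
    rw [← Algebra.smul_def, smul_assoc]
    refine Submodule.smul_mem _ _ (Submodule.subset_span ?_)
    have hdeg : ∀ i, e i < m + 1 := fun i => Nat.lt_succ_of_le <|
      (Finset.single_le_sum (f := e) (fun _ _ => Nat.zero_le _) (Finset.mem_univ i)).trans <| by
        have := (MvPolynomial.le_totalDegree he).trans hp
        rwa [Finsupp.sum_fintype _ _ fun _ => rfl] at this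
    exact Finset.mem_coe.mpr (Finset.mem_image.mpr
      ⟨(j, fun i => ⟨e i, hdeg i⟩), Finset.mem_univ _, rfl⟩)
  refine (length_submodule_mono hle).trans ((length_span_le a _ fun x hx r hr => ?_).trans ?_)
  · obtain ⟨q, -, rfl⟩ := Finset.mem_image.mp hx
    rw [smul_comm, hu _ r hr, smul_zero]
  · gcongr
    refine Finset.card_image_le.trans ?_
    simp

end PolySpan

variable [IsScalarTower R G L] (ℳ : ℕ → Submodule R L) [DirectSum.Decomposition ℳ]

/-- A homogeneous submodule all of whose elements are polynomial combinations, in `s` variables, of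
finitely many elements grows at most like a polynomial of degree `s`. -/
lemma exists_sum_hilb_le_of_polySpan [IsNoetherianRing R] [IsLocalRing R] [GradedAlgebra 𝒜]
    [SetLike.GradedSMul 𝒜 ℳ] (hstd : ∀ n, 𝒜 n = 𝒜 1 ^ n) [IsNoetherianRing G] [IsNoetherian G L]
    {W : Submodule G L} (hW : IsHomog ℳ W)
    (hfin : ∀ n, Module.length R (gcomp ℳ W n) ≠ ⊤) {K : ℕ}
    (hK : ∀ x ∈ W, ∀ r ∈ IsLocalRing.maximalIdeal R ^ K, r • x = 0)
    {s : ℕ} {ι : Type*} [Finite ι] (Y : Fin s → G) (u : ι → L) (huW : ∀ j, u j ∈ W)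
    (hu : ∀ x ∈ W, ∃ m, x ∈ polySpan (R := R) Y u m) :
    ∃ C, ∀ n, ∑ i ∈ Finset.range (n + 1), hilb ℳ W i ≤ C * (n + 1) ^ s := by
  have h0 : 𝒜 0 = 1 := by rw [hstd, pow_zero]
  obtain ⟨t, ht⟩ := exists_finset_span_gcomp 𝒜 𝒜 h0 (⊤ : Ideal G) 1
  obtain ⟨D, hD⟩ := exists_smul_mem_polySpan Y u huW hu t
  obtain ⟨c, hc⟩ := exists_forall_gcomp_succ_le 𝒜 ℳ hstd W
  have hcomp : ∀ n, ∃ m, gcomp ℳ W n ≤ polySpan (R := R) Y u m := by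
    intro n
    obtain ⟨t, ht⟩ := exists_finset_span_gcomp 𝒜 ℳ h0 W n
    rw [← ht]
    exact exists_subset_polySpan Y u hu t fun x hx => (ht.le (Submodule.subset_span hx)).1
  choose f hf using hcomp
  set m₀ := (Finset.range (c + 1)).sup f
  have hle : ∀ n, gcomp ℳ W n ≤ polySpan (R := R) Y u (m₀ + D * n) := by
    intro n
    induction n with
    | zero => exact (hf 0).trans (polySpan_mono Y u (le_add_right (Finset.le_sup (by simp))))
    | succ n ih =>
      rcases lt_or_ge n c with h | h
      · exact (hf _).trans (polySpan_mono Y u (le_add_right (Finset.le_sup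
          (Finset.mem_range.mpr (by omega)))))
      · refine hc n h _ fun a ha v hv => ?_
        rw [mul_add, mul_one, ← add_assoc]
        exact hD _ a (ht.ge ⟨trivial, ha⟩) v (ih hv)
  have htrunc : ∀ n, trunc ℳ W (n + 1) ≤ polySpan (R := R) Y u (m₀ + D * n) := by
    intro n x hx
    obtain ⟨hxW, hx⟩ := (mem_trunc ℳ).mp hx
    obtain ⟨S, hS⟩ := exists_sum_gproj ℳ x
    rw [hS]
    refine sum_mem fun i _ => ?_
    rcases lt_or_ge n i with h | h
    · rw [hx i h]
      exact zero_mem _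
    · exact polySpan_mono Y u (by gcongr) (hle i ⟨hW i x hxW, gproj_mem ℳ i x⟩)
  obtain ⟨ℓ, hℓ⟩ := ENat.ne_top_iff_exists.mp (length_quotient_maximalIdeal_pow_ne_top (R := R) K)
  refine ⟨Nat.card ι * (m₀ + D + 1) ^ s * ℓ, fun n => ?_⟩
  have key := (sum_hilb_eq_length_trunc ℳ hW hfin (n + 1)).le.trans
    ((length_submodule_mono (htrunc n)).trans
      (length_polySpan_le Y u (fun j => hK _ (huW j)) _))
  rw [← hℓ] at key
  have key' : ∑ i ∈ Finset.range (n + 1), hilb ℳ W i ≤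
      Nat.card ι * (m₀ + D * n + 1) ^ s * ℓ := by exact_mod_cast key
  calc _ ≤ Nat.card ι * (m₀ + D * n + 1) ^ s * ℓ := key'
    _ ≤ Nat.card ι * ((m₀ + D + 1) * (n + 1)) ^ s * ℓ := by
      gcongr
      nlinarith [Nat.zero_le (m₀ * n), Nat.zero_le n, Nat.zero_le D]
    _ = _ := by rw [mul_pow]; ring

/-- An algebra which is integral modulo a nil ideal is integral. -/
lemma isIntegral_quotient_of_le_radical {S : Type*} [CommRing S] (φ : S →+* G) {I Q : Ideal G}
    (hI : I ≤ Q.radical) (h : ((Ideal.Quotient.mk I).comp φ).IsIntegral) :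
    ((Ideal.Quotient.mk Q).comp φ).IsIntegral := by
  intro x
  obtain ⟨g, rfl⟩ := Ideal.Quotient.mk_surjective x
  obtain ⟨p, hp, hpg⟩ := h (Ideal.Quotient.mk I g)
  rw [← Polynomial.hom_eval₂, Ideal.Quotient.eq_zero_iff_mem] at hpg
  obtain ⟨M, hM⟩ := hI hpg
  refine ⟨p ^ M, hp.pow M, ?_⟩
  rw [← Polynomial.hom_eval₂, Polynomial.eval₂_pow, Ideal.Quotient.eq_zero_iff_mem]
  exact hM

lemma exists_sum_hilb_le [IsNoetherianRing R] [IsLocalRing R] [GradedAlgebra 𝒜]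
    [SetLike.GradedSMul 𝒜 ℳ] (hstd : ∀ n, 𝒜 n = 𝒜 1 ^ n) [IsNoetherianRing G] [IsNoetherian G L]
    {W : Submodule G L} (hW : IsHomog ℳ W)
    (hfin : ∀ n, Module.length R (gcomp ℳ W n) ≠ ⊤) {K : ℕ}
    (hK : ∀ x ∈ W, ∀ r ∈ IsLocalRing.maximalIdeal R ^ K, r • x = 0) {I : Ideal G}
    (hnI : (IsLocalRing.maximalIdeal R).map (algebraMap R G) ≤ I) (hI : I ≤ W.annihilator.radical)
    {e : ℕ} (he : ringKrullDim (G ⧸ I) ≤ e) :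
    ∃ C, ∀ n, ∑ i ∈ Finset.range (n + 1), hilb ℳ W i ≤ C * (n + 1) ^ e := by
  by_cases htop : I = ⊤
  · rw [htop, top_le_iff, Ideal.radical_eq_top, Submodule.annihilator_eq_top_iff] at hI
    subst hI
    refine ⟨0, fun n => ?_⟩
    have h : ∀ i, hilb ℳ (⊥ : Submodule G L) i = 0 := fun i => by
      have hbot : gcomp ℳ (⊥ : Submodule G L) i = ⊥ :=
        (Submodule.eq_bot_iff _).mpr fun x hx => hx.1
      rw [hilb, hbot, Module.length_bot]
      rfl
    simp [h]
  have := Ideal.Quotient.nontrivial_iff.mpr htop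
  have hft := finiteType_of_standard 𝒜 hstd
  have : Algebra.FiniteType R (G ⧸ I) := hft.of_surjective (Ideal.Quotient.mkₐ R I)
    (Ideal.Quotient.mkₐ_surjective R I)
  obtain ⟨s, y, hs, hint, -⟩ := exists_noether_normalization_of_isLocalRing R (B := G ⧸ I)
    fun r hr => Ideal.Quotient.eq_zero_iff_mem.mpr (hnI (Ideal.mem_map_of_mem _ hr))
  choose Y hY using fun i => Ideal.Quotient.mk_surjective (y i)
  have hse : s ≤ e := by
    rw [hs] at he
    exact_mod_cast he
  let φ : MvPolynomial (Fin s) R →+* G := (MvPolynomial.aeval Y : _ →ₐ[R] G).toRingHom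
  have hφ : (Ideal.Quotient.mk I).comp φ =
      (MvPolynomial.aeval y : MvPolynomial (Fin s) R →ₐ[R] G ⧸ I).toRingHom := by
    refine MvPolynomial.ringHom_ext (fun r => ?_) fun i => ?_
    · simp [φ]
    · simp [φ, hY]
  have hint' : ((Ideal.Quotient.mk W.annihilator).comp φ).IsIntegral :=
    isIntegral_quotient_of_le_radical φ hI (hφ ▸ hint)
  have hfinite : ((Ideal.Quotient.mk W.annihilator).comp φ).Finite := by
    refine hint'.to_finite (RingHom.FiniteType.of_comp_finiteType (f := MvPolynomial.C) ?_)
    have h1 : ((Ideal.Quotient.mk W.annihilator).comp φ).comp MvPolynomial.C =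
        (Ideal.Quotient.mk W.annihilator).comp (algebraMap R G) := by
      ext r
      simp [φ]
    rw [h1]
    exact RingHom.FiniteType.comp_surjective (RingHom.finiteType_algebraMap.mpr hft)
      Ideal.Quotient.mk_surjective
  obtain ⟨B, hB⟩ := hfinite
  obtain ⟨T, hT⟩ := IsNoetherian.noetherian W
  have hTW : ∀ x ∈ T, x ∈ W := fun x hx => hT.le (Submodule.subset_span hx)
  choose g hg using fun z : G ⧸ W.annihilator => Ideal.Quotient.mk_surjective z
  have hcongr : ∀ a b : G, Ideal.Quotient.mk W.annihilator a = Ideal.Quotient.mk W.annihilator b →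
      ∀ x ∈ W, a • x = b • x := fun a b hab x hx => by
    rw [← sub_eq_zero, ← sub_smul]
    exact Submodule.mem_annihilator.mp (Ideal.Quotient.eq.mp hab) x hx
  let u : T × B → L := fun q => g q.2 • (q.1 : L)
  have key : ∀ z : G ⧸ W.annihilator, ∀ x : T, ∃ m, g z • (x : L) ∈ polySpan (R := R) Y u m := by
    intro z x
    let _ := ((Ideal.Quotient.mk W.annihilator).comp φ).toAlgebra
    have hz : z ∈ Submodule.span (MvPolynomial (Fin s) R) (B : Set (G ⧸ W.annihilator)) :=
      hB ▸ Submodule.mem_top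
    induction hz using Submodule.span_induction with
    | mem z hz =>
      have := aeval_smul_mem_polySpan (R := R) Y u 1 (x, ⟨z, hz⟩)
      rw [map_one, one_smul] at this
      exact ⟨_, this⟩
    | zero =>
      refine ⟨0, ?_⟩
      rw [hcongr (g 0) 0 (by rw [hg, map_zero]) x (hTW x x.2), zero_smul]
      exact zero_mem _
    | add z₁ z₂ _ _ h₁ h₂ =>
      obtain ⟨m₁, h₁⟩ := h₁
      obtain ⟨m₂, h₂⟩ := h₂
      refine ⟨max m₁ m₂, ?_⟩
      rw [hcongr _ (g z₁ + g z₂) (by rw [map_add, hg, hg, hg]) x (hTW x x.2), add_smul]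
      exact add_mem (polySpan_mono Y u (le_max_left _ _) h₁)
        (polySpan_mono Y u (le_max_right _ _) h₂)
    | smul p z _ h =>
      obtain ⟨m, h⟩ := h
      refine ⟨p.totalDegree + m, ?_⟩
      rw [hcongr _ (MvPolynomial.aeval Y p * g z) (by rw [map_mul, hg, hg]; rfl) x (hTW x x.2),
        mul_smul]
      exact aeval_smul_mem_polySpan_add Y u le_rfl h
  have hu : ∀ x ∈ W, ∃ m, x ∈ polySpan (R := R) Y u m := by
    intro x hx
    suffices h : ∀ a : G, ∃ m, a • x ∈ polySpan (R := R) Y u m by simpa using h 1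
    rw [← hT] at hx
    induction hx using Submodule.span_induction with
    | mem x hx =>
      intro a
      obtain ⟨m, hm⟩ := key (Ideal.Quotient.mk _ a) ⟨x, hx⟩
      exact ⟨m, by rwa [hcongr a _ (hg _).symm x (hTW x hx)]⟩
    | zero => exact fun a => ⟨0, by rw [smul_zero]; exact zero_mem _⟩
    | add x y _ _ hx hy =>
      intro a
      obtain ⟨m₁, h₁⟩ := hx a
      obtain ⟨m₂, h₂⟩ := hy a
      refine ⟨max m₁ m₂, ?_⟩
      rw [smul_add]
      exact add_mem (polySpan_mono Y u (le_max_left _ _) h₁)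
        (polySpan_mono Y u (le_max_right _ _) h₂)
    | smul b x _ hx =>
      intro a
      rw [← mul_smul]
      exact hx (a * b)
  obtain ⟨C, hC⟩ := exists_sum_hilb_le_of_polySpan 𝒜 ℳ hstd hW hfin hK Y u
    (fun q => W.smul_mem _ (hTW _ q.1.2)) hu
  exact ⟨C, fun n => (hC n).trans (by gcongr; omega)⟩

end UpperBound

section Final

variable {A M : Type*} [CommRing A] [AddCommGroup M] [Module A M]

lemma annihilator_quotient_smul_top_le_radical [Module.Finite A M] {J : Ideal A}
    {Q : Ideal A} (hQ : Module.annihilator A M ≤ Q) (hJ : J ≤ Q.radical) :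
    Module.annihilator A (M ⧸ (J • ⊤ : Submodule A M)) ≤ Q.radical := by
  have h := Module.support_quotient (M := M) J
  rw [Module.support_eq_zeroLocus, Module.support_eq_zeroLocus] at h
  have hle : (Module.annihilator A (M ⧸ (J • ⊤ : Submodule A M)) : Set A) ⊆
      (PrimeSpectrum.vanishingIdeal (PrimeSpectrum.zeroLocus (Q : Set A)) : Set A) := by
    rw [← PrimeSpectrum.subset_zeroLocus_iff_subset_vanishingIdeal, h]
    refine Set.subset_inter (PrimeSpectrum.zeroLocus_anti_mono hQ) ?_
    rw [← PrimeSpectrum.zeroLocus_radical]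
    exact PrimeSpectrum.zeroLocus_anti_mono hJ
  rwa [PrimeSpectrum.vanishingIdeal_zeroLocus_eq_radical] at hle

lemma exists_colon_of_mem_minimalPrimes_annihilator [IsNoetherianRing A] [Module.Finite A M]
    {P : Ideal A} (hP : P ∈ (Module.annihilator A M).minimalPrimes) :
    ∃ w : M, ∀ a : A, a • w = 0 ↔ a ∈ P := by
  have h := Module.associatedPrimes.minimalPrimes_annihilator_subset_associatedPrimes A M hP
  obtain ⟨-, w, rfl⟩ := isAssociatedPrime_iff.mp h
  exact ⟨w, fun a => by simp [Submodule.mem_colon_singleton]⟩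

lemma le_annihilator_H0_radical [IsNoetherian A M] (J : Ideal A) :
    J ≤ (H0 J M).annihilator.radical := by
  obtain ⟨K, hK⟩ := exists_H0_eq_torsionBySet (L := M) J
  refine fun x hx => ⟨K, Submodule.mem_annihilator.mpr fun m hm => ?_⟩
  rw [hK, Submodule.mem_torsionBySet_iff] at hm
  exact hm ⟨x ^ K, Ideal.pow_mem_pow hx K⟩

lemma mem_H0_of_forall_smul_eq_zero {J : Ideal A} {w : M} (h : ∀ a ∈ J, a • w = 0) :
    w ∈ H0 J M := by
  refine Submodule.mem_iSup_of_mem 1 ?_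
  rw [Submodule.mem_torsionBySet_iff, pow_one]
  exact fun a => h a a.2

end Final

/-- Lemma 2.1: for a positively graded Noetherian ring `G = G₀[G₁]` with `(G₀, 𝔫)` local
with infinite residue field, a finitely generated graded `G`-module `L` and `d ≥ dim_G L`
positive, `j_d(G, L) ≠ 0` iff `ℓ(G, L) = d`, where `ℓ(G, L) = dim_G (L/𝔫L)`. -/
theorem stmt_0 {R G : Type*} [CommRing R] [IsNoetherianRing R] [IsLocalRing R]
    (hres : Infinite (IsLocalRing.ResidueField R))
    [CommRing G] [IsNoetherianRing G] [Algebra R G]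
    (𝒜 : ℕ → Submodule R G) [GradedAlgebra 𝒜]
    (hstd : ∀ n : ℕ, 𝒜 n = 𝒜 1 ^ n)
    (L : Type*) [AddCommGroup L] [Module R L] [Module G L] [IsScalarTower R G L]
    [Module.Finite G L]
    (ℳ : ℕ → Submodule R L) [DirectSum.Decomposition ℳ] [SetLike.GradedSMul 𝒜 ℳ]
    (d : ℕ) (hd : 0 < d) (hLd : mDim G L ≤ (d : WithBot ℕ∞)) :
    jMultGr R (Ideal.map (algebraMap R G) (IsLocalRing.maximalIdeal R)) L ℳ d ≠ 0 ↔
      mDim G (L ⧸ (Ideal.map (algebraMap R G) (IsLocalRing.maximalIdeal R) • ⊤ :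
        Submodule G L)) = (d : WithBot ℕ∞) := by
  have hnoeth : IsNoetherian G L := isNoetherian_of_isNoetherianRing_of_finite G L
  have h0 : 𝒜 0 = 1 := by rw [hstd, pow_zero]
  obtain ⟨e, rfl⟩ : ∃ e, d = e + 1 := ⟨d - 1, by omega⟩
  set J := Ideal.map (algebraMap R G) (IsLocalRing.maximalIdeal R) with hJ
  set I := Module.annihilator G (L ⧸ (J • ⊤ : Submodule G L)) with hI
  have hW : IsHomog ℳ (H0 J L) := isHomog_H0 ℳ _
  have hfin := length_gcomp_H0_ne_top (L := L) 𝒜 ℳ h0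
  have hpoly := eventuallyPoly_hilb 𝒜 ℳ hstd hfin hW
  have hj : jMultGr R J L ℳ (e + 1) = limUnder atTop (fun n : ℕ =>
      (e.factorial : ℝ) / (n : ℝ) ^ e * (hilb ℳ (H0 J L) n : ℝ)) := by
    simp only [jMultGr, hilb, mLength, Module.length_eq_height, Nat.add_sub_cancel]
  have hJI : J ≤ I := fun a ha => Module.mem_annihilator.mpr fun x => by
    obtain ⟨x, rfl⟩ := Submodule.Quotient.mk_surjective _ x
    rw [← Submodule.Quotient.mk_smul, Submodule.Quotient.mk_eq_zero]
    exact Submodule.smul_mem_smul ha trivial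
  have hLI : Module.annihilator G L ≤ I := fun a ha => Module.mem_annihilator.mpr fun x => by
    obtain ⟨x, rfl⟩ := Submodule.Quotient.mk_surjective _ x
    rw [← Submodule.Quotient.mk_smul, Module.mem_annihilator.mp ha, Submodule.Quotient.mk_zero]
  have hIW : I ≤ (H0 J L).annihilator.radical :=
    annihilator_quotient_smul_top_le_radical
      (fun a ha => Submodule.mem_annihilator.mpr fun x _ => Module.mem_annihilator.mp ha x)
      (le_annihilator_H0_radical J)
  obtain ⟨K, hK⟩ := exists_mem_H0_map_iff (L := L) (G := G) (IsLocalRing.maximalIdeal R)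
  have hupper : ∀ {k : ℕ}, ringKrullDim (G ⧸ I) ≤ k → ∃ C, ∀ n,
      ∑ i ∈ Finset.range (n + 1), hilb ℳ (H0 J L) i ≤ C * (n + 1) ^ k :=
    fun hk => exists_sum_hilb_le 𝒜 ℳ hstd hW hfin (fun x hx => (hK x).mp hx) hJI hIW hk
  have hdim : ringKrullDim (G ⧸ I) ≤ (e + 1 : ℕ) :=
    (ringKrullDim_le_of_surjective (Ideal.Quotient.factor hLI)
      (Ideal.Quotient.factor_surjective hLI)).trans hLd
  rw [hj]
  constructor
  · intro h
    by_contra hne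
    have hlt : ringKrullDim (G ⧸ I) ≤ e := by
      have hlt := lt_of_le_of_ne hdim hne
      cases hx : ringKrullDim (G ⧸ I) with
      | bot => exact bot_le
      | coe x =>
        have h' : (x : WithBot ℕ∞) < ((e + 1 : ℕ∞) : WithBot ℕ∞) := by
          rw [← hx]
          exact_mod_cast hlt
        exact WithBot.coe_le_coe.mpr (Order.le_of_lt_add_one (WithBot.coe_lt_coe.mp h'))
    obtain ⟨C, hC⟩ := hupper hlt
    exact h (limUnder_eq_zero_of_sum_le hpoly hC)
  · intro h
    obtain ⟨P, hP, hIP, hPd⟩ := exists_mem_minimalPrimes_of_le_ringKrullDim hLI hLd h.ge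
    obtain ⟨w, hw⟩ := exists_colon_of_mem_minimalPrimes_annihilator hP
    have := hP.1.1
    obtain ⟨C, hC⟩ := hupper hdim
    obtain ⟨A, c, hA⟩ := exists_pow_le_sum_hilb 𝒜 ℳ hstd hW hfin (hJI.trans hIP)
      (mem_H0_of_forall_smul_eq_zero fun a ha => (hw a).mpr (hIP (hJI ha)))
      (fun a => (hw a).mp) hd hPd
    exact limUnder_ne_zero_of_pow_le_sum hpoly hC hA

end
end

section
/- Let G = ⊕_{n≥0} G_n be a positively graded Noetherian ring with (G_0, 𝔫) local and G = G_0[G_1], and let L be a finitely generated graded G-module such that dim_{G_0}(L_n) < dim_G(L) for all n ≥ 0. If f ∈ G_1 is G_+-filter regular for L, then dim_G(L/fL) < dim_G(L), i.e., f is a parameter element for L. -/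
open Filter

noncomputable section

section StandardGraded

variable {R G : Type*} [CommRing R] [CommRing G] [Algebra R G]
  (𝒜 : ℕ → Submodule R G) [GradedAlgebra 𝒜]

/-- In a positively graded ring, every element differs from its degree zero component by an
element of the irrelevant ideal. -/
lemma sub_proj_zero_mem_gPlus (g : G) : g - GradedRing.proj 𝒜 0 g ∈ gPlus 𝒜 := by
  induction g using DirectSum.Decomposition.inductionOn 𝒜 with
  | zero => simp
  | @homogeneous i x =>
    rw [GradedRing.proj_apply]
    rcases Nat.eq_zero_or_pos i with rfl | hi
    · simp
    · rw [DirectSum.decompose_of_mem_ne 𝒜 x.2 hi.ne', sub_zero]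
      exact Ideal.subset_span ⟨i, hi, x.2⟩
  | add a b ha hb =>
    rw [map_add, add_sub_add_comm]
    exact add_mem ha hb

variable {𝒜}

/-- If `𝒜 0` is the image of `R`, primes containing the irrelevant ideal are ordered as their
contractions to `R`. -/
lemma le_of_comap_le_of_gPlus_le (h0 : 𝒜 0 = 1) {P Q : Ideal G}
    (hP : gPlus 𝒜 ≤ P) (hQ : gPlus 𝒜 ≤ Q)
    (h : P.comap (algebraMap R G) ≤ Q.comap (algebraMap R G)) : P ≤ Q := by
  intro g hg
  have hg0 : GradedRing.proj 𝒜 0 g ∈ (1 : Submodule R G) := by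
    rw [← h0, GradedRing.proj_apply]
    exact SetLike.coe_mem _
  obtain ⟨r, hr⟩ := Submodule.mem_one.mp hg0
  have hsub := sub_proj_zero_mem_gPlus 𝒜 g
  have hrP : algebraMap R G r ∈ P := by
    rw [hr, ← sub_sub_cancel g (GradedRing.proj 𝒜 0 g)]
    exact sub_mem hg (hP hsub)
  have hrQ : algebraMap R G r ∈ Q := h hrP
  rw [← sub_add_cancel g (GradedRing.proj 𝒜 0 g), ← hr]
  exact add_mem (by rw [hr]; exact hQ hsub) hrQ

/-- A Noetherian standard graded algebra is of finite type over its base. -/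
lemma finiteType_of_standardGraded [IsNoetherianRing G] (hstd : ∀ n : ℕ, 𝒜 n = 𝒜 1 ^ n) :
    Algebra.FiniteType R G := by
  classical
  have h0 : 𝒜 0 = 1 := by rw [hstd 0, pow_zero]
  obtain ⟨s, hs, hspan⟩ := (Submodule.fg_span_iff_fg_span_finset_subset (R := G)
    (𝒜 1 : Set G)).mp (IsNoetherian.noetherian _)
  have hle : 𝒜 1 ≤ Submodule.span R (s : Set G) := by
    intro x hx
    have hx' : x ∈ Submodule.span G (s : Set G) := hspan ▸ Submodule.subset_span hx
    obtain ⟨c, -, hc⟩ := Submodule.mem_span_finset.mp hx'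
    rw [← DirectSum.decompose_of_mem_same 𝒜 hx, ← GradedRing.proj_apply, ← hc, map_sum]
    refine sum_mem fun y hy ↦ ?_
    have hproj : GradedRing.proj 𝒜 1 (c y • y) = GradedRing.proj 𝒜 0 (c y) * y := by
      simpa using DirectSum.coe_decompose_mul_add_of_right_mem 𝒜 (i := 0) (a := c y) (hs hy)
    have hmem : GradedRing.proj 𝒜 0 (c y) ∈ (1 : Submodule R G) := by
      rw [← h0, GradedRing.proj_apply]
      exact SetLike.coe_mem _
    obtain ⟨r, hr⟩ := Submodule.mem_one.mp hmem
    rw [hproj, ← hr, ← Algebra.smul_def]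
    exact Submodule.smul_mem _ _ (Submodule.subset_span hy)
  have hpow : ∀ n, 𝒜 n ≤ Subalgebra.toSubmodule (Algebra.adjoin R (s : Set G)) := by
    intro n
    rw [hstd n]
    induction n with
    | zero =>
      rw [pow_zero, Submodule.one_le]
      exact one_mem (Algebra.adjoin R (s : Set G))
    | succ n ih =>
      rw [pow_succ, Submodule.mul_le]
      exact fun a ha b hb ↦
        (Algebra.adjoin R (s : Set G)).mul_mem (ih ha) (Algebra.span_le_adjoin R _ (hle hb))
  refine ⟨⟨s, eq_top_iff.mpr fun g _ ↦ ?_⟩⟩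
  rw [← DirectSum.sum_support_decompose 𝒜 g]
  exact sum_mem fun n _ ↦ hpow n (SetLike.coe_mem _)

/-- Algebras of finite type over a finite-dimensional Noetherian ring are finite-dimensional. -/
lemma ringKrullDim_lt_top_of_finiteType [IsNoetherianRing R] [FiniteRingKrullDim R]
    [Algebra.FiniteType R G] : ringKrullDim G < ⊤ := by
  obtain ⟨n, φ, hφ⟩ := Algebra.FiniteType.iff_quotient_mvPolynomial''.mp ‹Algebra.FiniteType R G›
  refine (ringKrullDim_le_of_surjective φ.toRingHom hφ).trans_lt ?_
  rw [MvPolynomial.ringKrullDim_of_isNoetherianRing]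
  obtain ⟨d, hd⟩ := WithBot.ne_bot_iff_exists.mp (ringKrullDim_ne_bot (R := R))
  have htop : d ≠ ⊤ := fun h ↦ (ringKrullDim_ne_top (R := R)) (by rw [← hd, h]; rfl)
  lift d to ℕ using htop
  rw [← hd]
  exact WithBot.coe_lt_coe.mpr (ENat.natCast_lt_top (d + Nat.card (Fin n)))

end StandardGraded

/-- For a prime `P` associated to a graded module, some component has its annihilator inside
the contraction of `P`. -/
lemma exists_annihilator_le_comap_of_mem_associatedPrimes {R G L : Type*} [CommRing R] [CommRing G]
    [Algebra R G] [AddCommGroup L] [Module R L] [Module G L] [IsScalarTower R G L]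
    (ℳ : ℕ → Submodule R L) [DirectSum.Decomposition ℳ] {P : Ideal G}
    (hP : P ∈ associatedPrimes G L) :
    ∃ n, Module.annihilator R (ℳ n) ≤ P.comap (algebraMap R G) := by
  classical
  obtain ⟨hprime, x, hx⟩ := hP
  by_contra! h
  have h' : ∀ n, ∃ r ∈ Module.annihilator R (ℳ n), r ∉ P.comap (algebraMap R G) :=
    fun n ↦ Set.not_subset.mp (h n)
  choose r hr hrP using h'
  set t := (DirectSum.decompose ℳ x).support
  have hprod : (∏ n ∈ t, r n) • x = 0 := by
    conv_lhs => rw [← DirectSum.sum_support_decompose ℳ x, Finset.smul_sum]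
    refine Finset.sum_eq_zero fun n hn ↦ ?_
    have hz : r n • (DirectSum.decompose ℳ x n : L) = 0 := by
      simpa using congrArg Subtype.val (Module.mem_annihilator.mp (hr n) (DirectSum.decompose ℳ x n))
    rw [← Finset.prod_erase_mul t r hn, mul_smul, hz, smul_zero]
  have hmem : ∏ n ∈ t, r n ∈ P.comap (algebraMap R G) := by
    rw [Ideal.mem_comap, hx]
    refine Ideal.le_radical ?_
    rwa [Submodule.mem_colon_singleton, Submodule.mem_bot, algebraMap_smul]
  obtain ⟨n, -, hn⟩ := (Ideal.IsPrime.prod_mem_iff (hp := hprime.comap _)).mp hmem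
  exact hrP n hn


/-- A chain of primes containing `I` bounds the dimension of `R ⧸ I` from below. -/
lemma length_le_ringKrullDim_quotient {R : Type*} [CommRing R] {I : Ideal R}
    (l : LTSeries (PrimeSpectrum R)) (h : I ≤ l.head.asIdeal) :
    (l.length : WithBot ℕ∞) ≤ ringKrullDim (R ⧸ I) := by
  rw [ringKrullDim_quotient, Order.le_krullDim_iff]
  exact ⟨⟨l.length, fun i ↦ ⟨l i, fun _ hx ↦ l.head_le i (h hx)⟩, fun i ↦ l.step i⟩, rfl⟩

/-- A prime at the bottom of a chain of maximal length in the support of `L` is associated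
to `L`. -/
lemma mem_associatedPrimes_of_length_eq_mDim {G L : Type*} [CommRing G] [IsNoetherianRing G]
    [AddCommGroup L] [Module G L] [Module.Finite G L] (l : LTSeries (PrimeSpectrum G))
    (hann : Module.annihilator G L ≤ l.head.asIdeal) (hl : mDim G L ≤ l.length) :
    l.head.asIdeal ∈ associatedPrimes G L := by
  apply Module.associatedPrimes.minimalPrimes_annihilator_subset_associatedPrimes
  refine ⟨⟨l.head.isPrime, hann⟩, fun Q ⟨hQ, hQann⟩ hQl ↦ ?_⟩
  by_contra hne
  let q : PrimeSpectrum G := ⟨Q, hQ⟩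
  let l' := l.cons q (lt_of_le_not_ge hQl hne)
  have hlen : ((l.length + 1 : ℕ) : WithBot ℕ∞) ≤ mDim G L := by
    rw [← show l'.length = l.length + 1 from RelSeries.cons_length ..]
    exact length_le_ringKrullDim_quotient l' (by simpa [l'] using hQann)
  exact absurd (Nat.cast_le.mp (hlen.trans hl)) (by simp)

/-- Lemma 2.2 (iii): if `dim_{G₀} Lₙ < dim_G L` for all `n ≥ 0` and `f ∈ G₁` is
`G₊`-filter regular for `L`, then `dim_G (L/fL) < dim_G L`, i.e. `f` is a parameter
element (superficial system of parameters element) for `L`. -/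
theorem stmt_3 {R G : Type*} [CommRing R] [IsNoetherianRing R] [IsLocalRing R]
    [CommRing G] [IsNoetherianRing G] [Algebra R G]
    (𝒜 : ℕ → Submodule R G) [GradedAlgebra 𝒜]
    (hstd : ∀ n : ℕ, 𝒜 n = 𝒜 1 ^ n)
    (L : Type*) [AddCommGroup L] [Module R L] [Module G L] [IsScalarTower R G L]
    [Module.Finite G L]
    (ℳ : ℕ → Submodule R L) [DirectSum.Decomposition ℳ] [SetLike.GradedSMul 𝒜 ℳ]
    (hcomp : ∀ n : ℕ, mDim R (ℳ n) < mDim G L)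
    (f : G) (hf1 : f ∈ 𝒜 1)
    (hreg : FilterRegular 𝒜 f L) :
    mDim G (L ⧸ (Ideal.span {f} • ⊤ : Submodule G L)) < mDim G L := by
  have h0 : 𝒜 0 = 1 := by rw [hstd 0, pow_zero]
  by_contra! hle
  have := finiteType_of_standardGraded hstd
  have hfin : mDim G L < ⊤ :=
    (ringKrullDim_quotient_le _).trans_lt (ringKrullDim_lt_top_of_finiteType (R := R))
  obtain ⟨e, he⟩ := WithBot.ne_bot_iff_exists.mp ((bot_le.trans_lt (hcomp 0)).ne')
  have htop : e ≠ ⊤ := fun h ↦ hfin.ne (by rw [← he, h]; rfl)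
  lift e to ℕ using htop
  rw [← he, mDim, ringKrullDim_quotient] at hle
  obtain ⟨l₀, hl₀⟩ := Order.le_krullDim_iff.mp hle
  let l : LTSeries (PrimeSpectrum G) := l₀.map Subtype.val fun _ _ h ↦ h
  have hl : l.length = e := hl₀
  have hhead : Module.annihilator G (L ⧸ (Ideal.span {f} • ⊤ : Submodule G L)) ≤
      l.head.asIdeal := l₀.head.2
  have hann : Module.annihilator G L ≤ l.head.asIdeal :=
    (LinearMap.annihilator_le_of_surjective _ (Submodule.mkQ_surjective _)).trans hhead
  have hf : f ∈ l.head.asIdeal := by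
    refine hhead (Module.mem_annihilator.mpr fun x ↦ ?_)
    obtain ⟨y, rfl⟩ := Submodule.mkQ_surjective _ x
    rw [← map_smul, Submodule.mkQ_apply, Submodule.Quotient.mk_eq_zero]
    exact Submodule.smul_mem_smul (Ideal.mem_span_singleton_self f) trivial
  have hass : l.head.asIdeal ∈ associatedPrimes G L :=
    mem_associatedPrimes_of_length_eq_mDim l hann (by rw [hl, ← he]; rfl)
  have hplus : gPlus 𝒜 ≤ l.head.asIdeal := by
    by_contra h
    exact hreg _ hass h hf
  obtain ⟨n, hn⟩ := exists_annihilator_le_comap_of_mem_associatedPrimes (R := R) ℳ hass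
  have hstep : ∀ i j, l i < l j → (l i).comap (algebraMap R G) < (l j).comap (algebraMap R G) :=
    fun i j hij ↦ lt_of_le_not_ge (Ideal.comap_mono hij.le) fun h ↦ hij.not_ge
      (le_of_comap_le_of_gPlus_le h0 (hplus.trans (l.head_le j)) (hplus.trans (l.head_le i)) h)
  let l' : LTSeries (PrimeSpectrum R) :=
    ⟨l.length, fun i ↦ (l i).comap (algebraMap R G), fun i ↦ hstep _ _ (l.step i)⟩
  refine (hcomp n).not_ge ?_
  have := length_le_ringKrullDim_quotient l' hn
  rw [← he]
  rw [show l'.length = e from hl] at this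
  exact this

end
end
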